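/- arXiv:1104.0920 — 2 statements merged into one kernel-verified Lean document; each statement's English description precedes it below -/
import Mathlib

section
/- Let T be a tree on n vertices with matching number β (so 1 ≤ β ≤ n/2). Then H(T) ≤ (6n² − 4βn + β² + 9β + 10n − 22)/24, with equality if and only if T is isomorphic to the spur A_{n,n−β}. -/
open Finset SimpleGraph

open Classical in
/-- The Harary index: half the sum, over ordered pairs of distinct vertices, of the
reciprocal of the shortest-path distance (so each unordered pair is counted once). -/
noncomputable def harary {V : Type*} [Fintype V] (G : SimpleGraph V) : ℝ :=
  (∑ u : V, ∑ v : V, if u = v then 0 else (1 : ℝ) / (G.dist u v)) / 2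

/-- The path graph `P_n` on `n` vertices. -/
def pathG (n : ℕ) : SimpleGraph (Fin n) :=
  SimpleGraph.fromRel (fun x y => (y : ℕ) = (x : ℕ) + 1)

/-- The star graph `S_n` on `n` vertices, with center `0`. -/
def starG (n : ℕ) : SimpleGraph (Fin n) :=
  SimpleGraph.fromRel (fun x y => (x : ℕ) = 0 ∧ (y : ℕ) ≠ 0)

/-- The spider (starlike tree) `S(L 0, …, L (k-1))`: a center `none` together with `k`
disjoint paths, the `i`-th having `L i` vertices, the center joined to vertex `0` of each leg. -/
def spider {k : ℕ} (L : Fin k → ℕ) : SimpleGraph (Option (Σ i : Fin k, Fin (L i))) :=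
  SimpleGraph.fromRel (fun x y =>
    (∃ (i : Fin k) (j : Fin (L i)), x = none ∧ y = some ⟨i, j⟩ ∧ (j : ℕ) = 0) ∨
    (∃ (i : Fin k) (j j' : Fin (L i)),
      x = some ⟨i, j⟩ ∧ y = some ⟨i, j'⟩ ∧ (j' : ℕ) = (j : ℕ) + 1))

/-- Leg lengths of the balanced starlike tree `BS n k`: the legs sum to `n - 1` and
pairwise differ by at most `1`. -/
def balancedLegs (n k : ℕ) : Fin k → ℕ :=
  fun i => (n - 1) / k + if (i : ℕ) < (n - 1) % k then 1 else 0

/-- The balanced starlike tree `BS_{n,k}` on `n` vertices with `k` legs of almost equal length. -/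
def BS (n k : ℕ) : SimpleGraph (Option (Σ i : Fin k, Fin (balancedLegs n k i))) :=
  spider (balancedLegs n k)

/-- Leg lengths of the broom `B_{n,k}`: one leg with `n - k` vertices, `k - 1` legs with one. -/
def broomLegs (n k : ℕ) : Fin k → ℕ := fun i => if (i : ℕ) = 0 then n - k else 1

/-- The broom `B_{n,k} = S(n-k, 1, …, 1)`. -/
def broom (n k : ℕ) : SimpleGraph (Option (Σ i : Fin k, Fin (broomLegs n k i))) :=
  spider (broomLegs n k)

/-- Leg lengths of the spur `A_{n,m}`: `n - m - 1` legs with two vertices, the rest with one. -/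
def spurLegs (n m : ℕ) : Fin m → ℕ := fun i => if (i : ℕ) < n - m - 1 then 2 else 1

/-- The spur `A_{n,m}`: the star `S_{m+1}` with a pendent edge attached to `n - m - 1`
of its pendent vertices. -/
def spur (n m : ℕ) : SimpleGraph (Option (Σ i : Fin m, Fin (spurLegs n m i))) :=
  spider (spurLegs n m)

/-- The caterpillar `C_{n,d,i}`: a path `v_0 v_1 … v_d` with `n - d - 1` pendent
vertices attached at `v_i`. -/
def caterpillar (n d i : ℕ) : SimpleGraph (Fin (d + 1) ⊕ Fin (n - d - 1)) :=
  SimpleGraph.fromRel (fun x y =>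
    (∃ a b : Fin (d + 1), x = Sum.inl a ∧ y = Sum.inl b ∧ (b : ℕ) = (a : ℕ) + 1) ∨
    (∃ (a : Fin (d + 1)) (p : Fin (n - d - 1)), (a : ℕ) = i ∧ x = Sum.inl a ∧ y = Sum.inr p))

/-- Degree of a vertex. -/
noncomputable def deg {V : Type*} [Fintype V] (G : SimpleGraph V) (v : V) : ℕ :=
  (G.neighborSet v).ncard

/-- Eccentricity of a vertex: the maximum distance to another vertex. -/
noncomputable def ecc {V : Type*} [Fintype V] (G : SimpleGraph V) (v : V) : ℕ :=
  Finset.univ.sup fun u => G.dist v u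

/-- Diameter of a graph: the maximum eccentricity. -/
noncomputable def graphDiam {V : Type*} [Fintype V] (G : SimpleGraph V) : ℕ :=
  Finset.univ.sup fun v => ecc G v

/-- Radius of a graph: the minimum eccentricity. -/
noncomputable def graphRadius {V : Type*} [Fintype V] (G : SimpleGraph V) : ℕ :=
  sInf (Set.range fun v => ecc G v)

/-- Matching number: the maximum cardinality of a set of pairwise non-incident edges. -/
noncomputable def matchingNumber {V : Type*} [Fintype V] (G : SimpleGraph V) : ℕ :=
  sSup {k | ∃ M : Finset (Sym2 V), M.card = k ∧ (∀ e ∈ M, e ∈ G.edgeSet) ∧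
    ∀ e ∈ M, ∀ f ∈ M, e ≠ f → ∀ v : V, ¬(v ∈ e ∧ v ∈ f)}

/-- Independence number: the maximum cardinality of a set of pairwise non-adjacent vertices. -/
noncomputable def indepNum {V : Type*} [Fintype V] (G : SimpleGraph V) : ℕ :=
  sSup {k | ∃ s : Finset V, s.card = k ∧ ∀ u ∈ s, ∀ v ∈ s, u ≠ v → ¬ G.Adj u v}



section Distance

variable {V : Type*}

lemma SimpleGraph.Connected.exists_adj_dist_eq_dist_add_one {G : SimpleGraph V}
    (hG : G.Connected) {v u : V} (h : v ≠ u) :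
    ∃ y, G.Adj v y ∧ G.dist v u = G.dist y u + 1 := by
  obtain ⟨p, hp⟩ := hG.exists_walk_length_eq_dist v u
  cases p with
  | nil => exact absurd rfl h
  | @cons _ y _ hadj q =>
    refine ⟨y, hadj, ?_⟩
    have h₁ := dist_le q
    have h₂ := hG.dist_triangle (u := v) (v := y) (w := u)
    rw [dist_eq_one_iff_adj.mpr hadj] at h₂
    rw [Walk.length_cons] at hp
    omega

/-- Distances from a leaf are one more than distances from its neighbor. -/
lemma SimpleGraph.Connected.dist_leaf {G : SimpleGraph V} (hG : G.Connected) {v w u : V}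
    (hleaf : ∀ z, G.Adj v z → z = w) (hu : v ≠ u) : G.dist v u = G.dist w u + 1 := by
  obtain ⟨y, hy, hd⟩ := hG.exists_adj_dist_eq_dist_add_one hu
  rwa [hleaf y hy] at hd

/-- Two neighbors of a vertex of a tree that are both closer to the root coincide. -/
lemma SimpleGraph.IsTree.parent_unique {T : SimpleGraph V} (hT : T.IsTree) {r v a b : V}
    (ha : T.Adj v a) (hb : T.Adj v b) (hda : T.dist r a + 1 = T.dist r v)
    (hdb : T.dist r b + 1 = T.dist r v) : a = b := by
  obtain ⟨q, hq, hql⟩ := hT.connected.exists_path_of_dist r v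
  have key : ∀ c, T.Adj v c → T.dist r c + 1 = T.dist r v → c = q.penultimate := by
    intro c hc hdc
    refine hT.isAcyclic.eq_penultimate_of_adj_end hq hc ?_
    by_contra hmem
    obtain ⟨p, hp, hpl⟩ := hT.connected.exists_path_of_dist r c
    have := (hT.existsUnique_path r c).unique hp (hq.concat hmem hc)
    have := congrArg Walk.length this
    rw [Walk.length_concat] at this
    omega
  rw [key a ha hda, key b hb hdb]

lemma SimpleGraph.IsTree.dist_induce {T : SimpleGraph V} (hT : T.IsTree) {S : Set V}
    (hS : (T.induce S).Connected) (a b : S) : (T.induce S).dist a b = T.dist a b := by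
  obtain ⟨p, hp, hpl⟩ := hS.exists_path_of_dist a b
  obtain ⟨q, hq, hql⟩ := hT.connected.exists_path_of_dist (a : V) b
  have hinj : Function.Injective (Embedding.induce (G := T) S).toHom := Subtype.val_injective
  have := (hT.existsUnique_path (a : V) b).unique hq (hp.map hinj)
  rw [← hpl, ← hql, this]
  exact (Walk.length_map _ p).symm

lemma SimpleGraph.IsTree.induce_compl_leaf [Finite V] {T : SimpleGraph V} (hT : T.IsTree)
    {v w : V} (hvw : T.Adj v w) (hleaf : ∀ z, T.Adj v z → z = w) :
    (T.induce {v}ᶜ).IsTree := by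
  classical
  have := Fintype.ofFinite V
  refine ⟨hT.connected.induce_compl_singleton_of_degree_eq_one ?_, hT.isAcyclic.induce _⟩
  exact degree_eq_one_iff_existsUnique_adj.mpr ⟨w, hvw, hleaf⟩

/-- A tree on at least three vertices has a leaf `v` such that all but at most one of the other
neighbors of the neighbor of `v` are leaves as well. -/
lemma SimpleGraph.IsTree.exists_deep_leaf [Fintype V] {T : SimpleGraph V} (hT : T.IsTree)
    (hn : 3 ≤ Fintype.card V) :
    ∃ v w x, T.Adj v w ∧ (∀ z, T.Adj v z → z = w) ∧ T.Adj w x ∧ x ≠ v ∧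
      ∀ y, T.Adj w y → y ≠ x → ∀ z, T.Adj y z → z = w := by
  obtain ⟨r⟩ := hT.connected.nonempty
  obtain ⟨v, -, hmax⟩ := Finset.exists_max_image univ (T.dist r) ⟨r, mem_univ r⟩
  have hstep : ∀ y z, T.dist r y = T.dist r v → T.Adj y z → T.dist r z + 1 = T.dist r y := by
    intro y z hy hyz
    have h₁ := hmax z (mem_univ z)
    have h₂ := hT.dist_eq_dist_add_one_of_adj r hyz
    omega
  have hleaf : ∀ y w, T.dist r y = T.dist r v → T.Adj y w → ∀ z, T.Adj y z → z = w :=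
    fun y w hy hw z hz => hT.parent_unique hz hw (hstep y z hy hz) (hstep y w hy hw)
  have hvr : v ≠ r := by
    rintro rfl
    obtain ⟨u, hu⟩ := Fintype.exists_ne_of_one_lt_card (by omega : 1 < Fintype.card V) v
    have h₁ := hmax u (mem_univ u)
    have h₂ := hT.connected.pos_dist_of_ne hu.symm
    rw [dist_self] at h₁
    omega
  obtain ⟨w, hvw, hdw⟩ := hT.connected.exists_adj_dist_eq_dist_add_one hvr
  rw [dist_comm, dist_comm (u := w)] at hdw
  by_cases hwr : w = r
  · subst hwr
    classical
    obtain ⟨u, hu⟩ : ∃ u, u ∉ ({v, w} : Finset V) := by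
      by_contra! h
      have h₁ := Finset.card_le_card (fun u _ => h u : univ ⊆ ({v, w} : Finset V))
      have h₂ := Finset.card_le_two (a := v) (b := w)
      rw [card_univ] at h₁
      omega
    simp only [mem_insert, mem_singleton, not_or] at hu
    obtain ⟨x, hx, hdx⟩ := hT.connected.exists_adj_dist_eq_dist_add_one (Ne.symm hu.2)
    have hd := hT.connected.dist_leaf (hleaf v w rfl hvw) (Ne.symm hu.1)
    refine ⟨v, w, x, hvw, hleaf v w rfl hvw, hx, ?_, ?_⟩
    · rintro rfl
      omega
    · intro y hy _
      refine hleaf y w ?_ hy.symm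
      rw [dist_eq_one_iff_adj.mpr hy, dist_eq_one_iff_adj.mpr hvw.symm]
  · obtain ⟨x, hx, hdx⟩ := hT.connected.exists_adj_dist_eq_dist_add_one hwr
    rw [dist_comm, dist_comm (u := x)] at hdx
    refine ⟨v, w, x, hvw, hleaf v w rfl hvw, hx, ?_, ?_⟩
    · rintro rfl
      omega
    · intro y hy hyx
      refine hleaf y w ?_ hy.symm
      have h₁ := hT.dist_eq_dist_add_one_of_adj r hy
      by_contra hne
      exact hyx (hT.parent_unique (r := r) hy hx (by omega) (by omega))

end Distance

section Harary

variable {V : Type*} [Fintype V]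

/-- The set of neighbors of a vertex, as a finset. -/
noncomputable def nbrs (G : SimpleGraph V) (x : V) : Finset V := by
  classical exact univ.filter (G.Adj x)

@[simp] lemma mem_nbrs {G : SimpleGraph V} {x y : V} : y ∈ nbrs G x ↔ G.Adj x y := by
  simp [nbrs]

lemma harary_eq_sum (G : SimpleGraph V) :
    harary G = (∑ u : V, ∑ v : V, (1 : ℝ) / (G.dist u v)) / 2 := by
  unfold harary
  congr 1
  refine sum_congr rfl fun u _ => sum_congr rfl fun v _ => ?_
  split_ifs with h
  · simp [h]
  · rfl

lemma harary_eq_harary_induce_add {T : SimpleGraph V} (hT : T.IsTree) {v : V}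
    [Fintype ({v}ᶜ : Set V)] (hS : (T.induce {v}ᶜ).Connected) :
    harary T = harary (T.induce {v}ᶜ) + ∑ u, (1 : ℝ) / (T.dist v u) := by
  classical
  have hsub : ∀ f : V → ℝ, ∑ u, f u = f v + ∑ u : ({v}ᶜ : Set V), f u := by
    intro f
    rw [Fintype.sum_eq_add_sum_compl v]
    congr 1
    exact Finset.sum_subtype _ (by simp) f
  simp only [harary_eq_sum, hT.dist_induce hS]
  rw [hsub fun u => ∑ w, (1 : ℝ) / (T.dist u w)]
  simp only [hsub (fun w => (1 : ℝ) / (T.dist _ w))]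
  rw [Finset.sum_add_distrib]
  simp only [dist_comm (v := v), dist_self]
  simp
  ring

lemma card_induce_compl_singleton (v : V) [Fintype ({v}ᶜ : Set V)] :
    Fintype.card ({v}ᶜ : Set V) + 1 = Fintype.card V := by
  classical
  have : 0 < Fintype.card V := Fintype.card_pos_iff.mpr ⟨v⟩
  rw [Fintype.card_compl_set]
  simp
  omega

lemma card_nbrs_induce {T : SimpleGraph V} {v w x : V} [Fintype ({v}ᶜ : Set V)]
    (hleaf : ∀ z, T.Adj v z → z = w) (hx : x ≠ v) (hxw : x ≠ w) :
    (nbrs (T.induce {v}ᶜ) ⟨x, hx⟩).card = (nbrs T x).card := by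
  refine Finset.card_bij (fun a _ => a) ?_ ?_ ?_
  · intro a ha
    simpa using ha
  · intro a _ b _ h
    exact Subtype.ext h
  · intro b hb
    rw [mem_nbrs] at hb
    have hbv : b ≠ v := by
      rintro rfl
      exact hxw (hleaf x hb.symm)
    exact ⟨⟨b, hbv⟩, by simpa using hb, rfl⟩

/-- Reciprocal distances from a leaf `v` with neighbor `w`. -/
lemma sum_one_div_dist_leaf_le {G : SimpleGraph V} (hG : G.Connected) {v w : V}
    (hvw : G.Adj v w) (hleaf : ∀ z, G.Adj v z → z = w) :
    ∑ u, (1 : ℝ) / (G.dist v u) ≤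
      (Fintype.card V : ℝ) / 3 + ((nbrs G w).card : ℝ) / 6 + 1 / 6 := by
  classical
  calc ∑ u, (1 : ℝ) / (G.dist v u)
      ≤ ∑ u, ((1 / 3 : ℝ) + (if u ∈ nbrs G w then 1 / 6 else 0) + (if u = w then 2 / 3 else 0)
          + (if u = v then -(1 / 2) else 0)) := by
        refine Finset.sum_le_sum fun u _ => ?_
        by_cases huv : u = v
        · subst huv
          simp [hvw.symm, hvw.ne]
          norm_num
        by_cases huw : u = w
        · subst huw
          simp [huv, dist_eq_one_iff_adj.mpr hvw]
          norm_num
        rw [hG.dist_leaf hleaf (Ne.symm huv)]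
        by_cases hadj : G.Adj w u
        · simp [huv, huw, hadj, dist_eq_one_iff_adj.mpr hadj]
          norm_num
        · have h2 : (2 : ℝ) ≤ G.dist w u := by
            exact_mod_cast hG.one_lt_dist_of_ne_of_not_adj (Ne.symm huw) hadj
          simp only [mem_nbrs, hadj, huw, huv, if_false, add_zero]
          push_cast
          exact one_div_le_one_div_of_le (by norm_num) (by linarith)
    _ = _ := by
        simp only [Finset.sum_add_distrib, Finset.sum_ite_mem, Finset.sum_ite_eq', mem_univ,
          if_true, Finset.sum_const, Finset.univ_inter, card_univ, nsmul_eq_mul]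
        ring

/-- Reciprocal distances from a leaf `v` whose neighbor `w` has `x` as its only other neighbor. -/
lemma sum_one_div_dist_pendent_path_le {G : SimpleGraph V} (hG : G.Connected) {v w x : V}
    (hvw : G.Adj v w) (hleaf : ∀ z, G.Adj v z → z = w) (hwx : G.Adj w x) (hxv : x ≠ v)
    (hw : ∀ z, G.Adj w z → z = v ∨ z = x) :
    ∑ u, (1 : ℝ) / (G.dist v u) ≤
      (Fintype.card V : ℝ) / 4 + ((nbrs G x).card : ℝ) / 12 + 2 / 3 := by
  classical
  have hdist : ∀ u, u ≠ v → u ≠ w → G.dist v u = G.dist x u + 2 := by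
    intro u huv huw
    have h₁ := hG.dist_leaf hleaf (Ne.symm huv)
    obtain ⟨y, hy, hd⟩ := hG.exists_adj_dist_eq_dist_add_one (Ne.symm huw)
    rcases hw y hy with rfl | rfl <;> omega
  have hxv' : ¬ G.Adj x v := fun h => hwx.ne (hleaf x h.symm).symm
  calc ∑ u, (1 : ℝ) / (G.dist v u)
      ≤ ∑ u, ((1 / 4 : ℝ) + (if u ∈ nbrs G x then 1 / 12 else 0) + (if u = x then 1 / 4 else 0)
          + (if u = w then 2 / 3 else 0) + (if u = v then -(1 / 4) else 0)) := by
        refine Finset.sum_le_sum fun u _ => ?_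
        by_cases huv : u = v
        · subst huv
          simp [hxv', hvw.ne, hxv.symm]
        by_cases huw : u = w
        · subst huw
          simp [huv, hwx.symm, hwx.ne, dist_eq_one_iff_adj.mpr hvw]
          norm_num
        rw [hdist u huv huw]
        by_cases hux : u = x
        · subst hux
          simp [huv, huw]
          norm_num
        by_cases hadj : G.Adj x u
        · simp [huv, huw, hux, hadj, dist_eq_one_iff_adj.mpr hadj]
          norm_num
        · have h2 : (2 : ℝ) ≤ G.dist x u := by
            exact_mod_cast hG.one_lt_dist_of_ne_of_not_adj (Ne.symm hux) hadj
          simp only [mem_nbrs, hadj, huw, huv, hux, if_false, add_zero]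
          push_cast
          exact one_div_le_one_div_of_le (by norm_num) (by linarith)
    _ = _ := by
        simp only [Finset.sum_add_distrib, Finset.sum_ite_mem, Finset.sum_ite_eq', mem_univ,
          if_true, Finset.sum_const, Finset.univ_inter, card_univ, nsmul_eq_mul]
        ring

end Harary

section Matching

variable {V W : Type*}

/-- A finite set of pairwise non-incident edges of `G`. -/
def IsEdgeMatching (G : SimpleGraph V) (M : Finset (Sym2 V)) : Prop :=
  (∀ e ∈ M, e ∈ G.edgeSet) ∧ ∀ e ∈ M, ∀ f ∈ M, e ≠ f → ∀ v : V, ¬(v ∈ e ∧ v ∈ f)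

lemma IsEdgeMatching.eq_of_mem {G : SimpleGraph V} {M : Finset (Sym2 V)}
    (hM : IsEdgeMatching G M) {e f : Sym2 V} (he : e ∈ M) (hf : f ∈ M) {v : V} (hve : v ∈ e)
    (hvf : v ∈ f) : e = f := by
  by_contra h
  exact hM.2 e he f hf h v ⟨hve, hvf⟩

lemma IsEdgeMatching.subset {G : SimpleGraph V} {M N : Finset (Sym2 V)}
    (hM : IsEdgeMatching G M) (h : N ⊆ M) : IsEdgeMatching G N :=
  ⟨fun e he => hM.1 e (h he), fun e he f hf => hM.2 e (h he) f (h hf)⟩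

lemma IsEdgeMatching.singleton {G : SimpleGraph V} {a b : V} (h : G.Adj a b) :
    IsEdgeMatching G {s(a, b)} := by
  refine ⟨fun e he => ?_, fun e he f hf hef => ?_⟩
  · rw [Finset.mem_singleton.mp he]
    exact h
  · exact absurd ((Finset.mem_singleton.mp he).trans (Finset.mem_singleton.mp hf).symm) hef

lemma IsEdgeMatching.map {G : SimpleGraph V} {H : SimpleGraph W} (f : H ↪g G)
    {M : Finset (Sym2 W)} (hM : IsEdgeMatching H M) :
    IsEdgeMatching G (M.map f.toEmbedding.sym2Map) := by
  refine ⟨fun e he => ?_, fun e he e' he' hne v hv => ?_⟩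
  · obtain ⟨a, ha, rfl⟩ := Finset.mem_map.mp he
    exact f.toHom.map_mem_edgeSet (hM.1 a ha)
  · obtain ⟨a, ha, rfl⟩ := Finset.mem_map.mp he
    obtain ⟨b, hb, rfl⟩ := Finset.mem_map.mp he'
    obtain ⟨x, hx, rfl⟩ := Sym2.mem_map.mp hv.1
    obtain ⟨y, hy, hxy⟩ := Sym2.mem_map.mp hv.2
    rw [f.injective hxy] at hy
    exact hne (by rw [hM.eq_of_mem ha hb hx hy])

lemma IsEdgeMatching.exists_pullback {G : SimpleGraph V} {H : SimpleGraph W} (f : H ↪g G)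
    {M : Finset (Sym2 V)} (hM : IsEdgeMatching G M)
    (hr : ∀ e ∈ M, ∀ v ∈ e, v ∈ Set.range f) :
    ∃ N : Finset (Sym2 W), IsEdgeMatching H N ∧ N.card = M.card := by
  classical
  have hinj : Function.Injective (Sym2.map f) := Sym2.map.injective f.injective
  refine ⟨M.preimage (Sym2.map f) hinj.injOn, ⟨fun e he => ?_, fun e he e' he' hne v hv => ?_⟩, ?_⟩
  · have h := hM.1 _ (Finset.mem_preimage.mp he)
    induction e with
    | _ a b => simpa using h
  · refine hne (hinj (hM.eq_of_mem (Finset.mem_preimage.mp he) (Finset.mem_preimage.mp he')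
      (v := f v) ?_ ?_))
    · exact Sym2.mem_map.mpr ⟨v, hv.1, rfl⟩
    · exact Sym2.mem_map.mpr ⟨v, hv.2, rfl⟩
  · rw [← Finset.card_image_of_injective _ hinj, Finset.image_preimage]
    congr 1
    refine Finset.filter_true_of_mem fun e he => ?_
    induction e with
    | _ a b =>
      obtain ⟨a', rfl⟩ := hr _ he a (Sym2.mem_mk_left a b)
      obtain ⟨b', rfl⟩ := hr _ he b (Sym2.mem_mk_right _ b)
      exact ⟨s(a', b'), rfl⟩

/-- In an acyclic graph, the edges of a matching have distinct representatives that are not adjacent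
to `x`. -/
lemma IsEdgeMatching.exists_not_adj {G : SimpleGraph V} (hG : G.IsAcyclic)
    {M : Finset (Sym2 V)} (hM : IsEdgeMatching G M) (x : V) :
    ∃ g : Sym2 V → V, Set.InjOn g M ∧ ∀ e ∈ M, g e ∈ e ∧ ¬ G.Adj x (g e) := by
  have key : ∀ e : Sym2 V, ∃ y, e ∈ M → y ∈ e ∧ ¬ G.Adj x y := by
    intro e
    induction e with
    | _ a b =>
      by_cases he : s(a, b) ∈ M
      · have hab : G.Adj a b := hM.1 _ he
        by_cases hxa : G.Adj x a
        · refine ⟨b, fun _ => ⟨Sym2.mem_mk_right a b, fun hxb => ?_⟩⟩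
          classical
          exact hG.cliqueFree le_rfl {x, a, b} (is3Clique_triple_iff.mpr ⟨hxa, hxb, hab⟩)
        · exact ⟨a, fun _ => ⟨Sym2.mem_mk_left a b, hxa⟩⟩
      · exact ⟨a, fun h => absurd h he⟩
  choose g hg using key
  refine ⟨g, fun e he f hf hef => ?_, fun e he => hg e he⟩
  exact hM.eq_of_mem he hf (hg e he).1 (hef ▸ (hg f hf).1)

variable [Fintype V]

lemma matchingNumber_bddAbove (G : SimpleGraph V) :
    BddAbove {k | ∃ M : Finset (Sym2 V), M.card = k ∧ (∀ e ∈ M, e ∈ G.edgeSet) ∧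
      ∀ e ∈ M, ∀ f ∈ M, e ≠ f → ∀ v : V, ¬(v ∈ e ∧ v ∈ f)} := by
  classical
  refine ⟨Fintype.card (Sym2 V), ?_⟩
  rintro k ⟨M, rfl, -⟩
  exact Finset.card_le_univ M

lemma IsEdgeMatching.card_le {G : SimpleGraph V} {M : Finset (Sym2 V)}
    (hM : IsEdgeMatching G M) : M.card ≤ matchingNumber G :=
  le_csSup (matchingNumber_bddAbove G) ⟨M, rfl, hM⟩

lemma exists_isEdgeMatching_card_eq (G : SimpleGraph V) :
    ∃ M : Finset (Sym2 V), IsEdgeMatching G M ∧ M.card = matchingNumber G := by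
  obtain ⟨M, hM, h⟩ := Nat.sSup_mem (s := {k | ∃ M : Finset (Sym2 V), M.card = k ∧
      (∀ e ∈ M, e ∈ G.edgeSet) ∧ ∀ e ∈ M, ∀ f ∈ M, e ≠ f → ∀ v : V, ¬(v ∈ e ∧ v ∈ f)})
    ⟨0, ∅, by simp⟩ (matchingNumber_bddAbove G)
  exact ⟨M, h, hM⟩

lemma IsEdgeMatching.card_le_of_range {G : SimpleGraph W} {H : SimpleGraph V} (f : H ↪g G)
    {M : Finset (Sym2 W)} (hM : IsEdgeMatching G M)
    (hr : ∀ e ∈ M, ∀ v ∈ e, v ∈ Set.range f) : M.card ≤ matchingNumber H := by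
  obtain ⟨N, hN, hc⟩ := hM.exists_pullback f hr
  rw [← hc]
  exact hN.card_le

lemma matchingNumber_le_of_embedding [Fintype W] {G : SimpleGraph V} {H : SimpleGraph W} (f : H ↪g G) :
    matchingNumber H ≤ matchingNumber G := by
  obtain ⟨M, hM, hc⟩ := exists_isEdgeMatching_card_eq H
  rw [← hc, ← Finset.card_map f.toEmbedding.sym2Map]
  exact (hM.map f).card_le

lemma card_compl_nbrs_add (G : SimpleGraph V) (x : V) [DecidableEq V] :
    ((nbrs G x)ᶜ).card + (nbrs G x).card = Fintype.card V := by
  rw [add_comm, Finset.card_add_card_compl]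

lemma matchingNumber_add_card_nbrs_le {G : SimpleGraph V} (hG : G.IsAcyclic) (x : V) :
    matchingNumber G + (nbrs G x).card ≤ Fintype.card V := by
  classical
  obtain ⟨M, hM, hc⟩ := exists_isEdgeMatching_card_eq G
  obtain ⟨g, hinj, hg⟩ := hM.exists_not_adj hG x
  have h := Finset.card_le_card_of_injOn (t := (nbrs G x)ᶜ) g
    (fun e he => by simpa using (hg e he).2) hinj
  have := card_compl_nbrs_add G x
  omega

/-- If the degree of `c` is as large as the matching number permits, then some injective map
sends every non-neighbor of `c` to one of its neighbors that is also a neighbor of `c`. -/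
lemma exists_partner_of_card_nbrs {G : SimpleGraph V} (hG : G.IsAcyclic) {c : V}
    (hc : matchingNumber G + (nbrs G c).card = Fintype.card V) :
    ∃ p : V → V, (∀ y, ¬ G.Adj c y → G.Adj y (p y) ∧ G.Adj c (p y)) ∧
      ∀ y z, ¬ G.Adj c y → ¬ G.Adj c z → p y = p z → y = z := by
  classical
  obtain ⟨M, hM, hcard⟩ := exists_isEdgeMatching_card_eq G
  obtain ⟨g, hinj, hg⟩ := hM.exists_not_adj hG c
  have hsurj : ∀ y, ¬ G.Adj c y → ∃ e ∈ M, g e = y := by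
    intro y hy
    have := card_compl_nbrs_add G c
    have := Finset.surjOn_of_injOn_of_card_le (t := (nbrs G c)ᶜ) g
      (fun e he => by simpa using (hg e he).2) hinj (by omega)
    obtain ⟨e, he, h⟩ := this (by simpa using hy : y ∈ ((nbrs G c)ᶜ : Finset V))
    exact ⟨e, he, h⟩
  have hp : ∀ y, ∃ z, ¬ G.Adj c y → G.Adj c z ∧ s(y, z) ∈ M := by
    intro y
    by_cases hy : G.Adj c y
    · exact ⟨y, fun h => absurd hy h⟩
    obtain ⟨e, he, rfl⟩ := hsurj y hy
    obtain ⟨z, hz⟩ := Sym2.mem_iff_exists.mp (hg e he).1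
    refine ⟨z, fun _ => ⟨?_, hz ▸ he⟩⟩
    by_contra hcz
    obtain ⟨f, hf, rfl⟩ := hsurj z hcz
    have hef : e = f := hM.eq_of_mem he hf (v := g f) (by rw [hz]; simp) (hg f hf).1
    subst hef
    have := hM.1 e he
    rw [hz] at this
    exact G.loopless.irrefl _ this
  choose p hp using hp
  refine ⟨p, fun y hy => ⟨hM.1 _ (hp y hy).2, (hp y hy).1⟩, fun y z hy hz hyz => ?_⟩
  have h := hM.eq_of_mem (hp y hy).2 (hp z hz).2 (v := p y) (by simp) (by simp [hyz])
  rw [hyz] at h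
  exact Sym2.congr_left.mp h

end Matching

section Bound

/-- The Harary index of the spur on `n` vertices with matching number `b`. -/
noncomputable def hararyBound (n b : ℝ) : ℝ :=
  (6 * n ^ 2 - 4 * b * n + b ^ 2 + 9 * b + 10 * n - 22) / 24

lemma harary_le_card_mul {V : Type*} [Fintype V] {G : SimpleGraph V} (hG : G.Connected) :
    harary G ≤ (Fintype.card V : ℝ) * ((Fintype.card V : ℝ) - 1) / 2 := by
  classical
  have h : ∑ u : V, ∑ v : V, (1 : ℝ) / (G.dist u v) ≤
      ∑ u : V, ∑ v : V, ((1 : ℝ) + if v = u then -1 else 0) := by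
    refine Finset.sum_le_sum fun u _ => Finset.sum_le_sum fun v _ => ?_
    by_cases huv : v = u
    · simp [huv]
    · have h1 : (1 : ℝ) ≤ G.dist u v := by
        exact_mod_cast hG.pos_dist_of_ne (Ne.symm huv)
      simp only [huv, if_false, add_zero]
      exact (div_le_one (by linarith)).mpr h1
  simp only [Finset.sum_add_distrib, Finset.sum_ite_eq', mem_univ, if_true, Finset.sum_const,
    card_univ, nsmul_eq_mul] at h
  rw [harary_eq_sum]
  linarith

lemma exists_adj_of_matchingNumber_pos {V : Type*} [Fintype V] {G : SimpleGraph V}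
    (h : 1 ≤ matchingNumber G) : ∃ a b, G.Adj a b := by
  obtain ⟨M, hM, hc⟩ := exists_isEdgeMatching_card_eq G
  obtain ⟨e, he⟩ := Finset.card_pos.mp (by omega : 0 < M.card)
  induction e with
  | _ a b => exact ⟨a, b, hM.1 _ he⟩

/-- If removing the leaf `v` lowers the matching number, then the edge at `v` is in every maximum
matching. -/
lemma leaf_edge_mem_of_matchingNumber_ne {V : Type*} [Fintype V] {T : SimpleGraph V} {v w : V}
    [Fintype ({v}ᶜ : Set V)] (hleaf : ∀ z, T.Adj v z → z = w)
    (hne : matchingNumber (T.induce {v}ᶜ) ≠ matchingNumber T) {M : Finset (Sym2 V)}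
    (hM : IsEdgeMatching T M) (hc : M.card = matchingNumber T) : s(v, w) ∈ M := by
  by_contra hmem
  have hle := matchingNumber_le_of_embedding (Embedding.induce (G := T) ({v}ᶜ : Set V))
  have hge := hM.card_le_of_range (Embedding.induce (G := T) ({v}ᶜ : Set V)) (by
    intro e he u hu
    by_contra hr
    have huv : u = v := by
      by_contra huv
      exact hr ⟨⟨u, huv⟩, rfl⟩
    subst huv
    obtain ⟨z, rfl⟩ := Sym2.mem_iff_exists.mp hu
    rw [hleaf z (hM.1 _ he)] at he
    exact hmem he)
  omega

/-- If removing a leaf lowers the matching number, then no other leaf has the same neighbor. -/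
lemma leaf_unique_of_matchingNumber_ne {V : Type*} [Fintype V] {T : SimpleGraph V} {v w y : V}
    [Fintype ({v}ᶜ : Set V)] (hvw : T.Adj v w) (hleaf : ∀ z, T.Adj v z → z = w)
    (hne : matchingNumber (T.induce {v}ᶜ) ≠ matchingNumber T)
    (hyw : T.Adj y w) (hyleaf : ∀ z, T.Adj y z → z = w) : y = v := by
  classical
  by_contra hyv
  obtain ⟨M, hM, hc⟩ := exists_isEdgeMatching_card_eq T
  have hmem := leaf_edge_mem_of_matchingNumber_ne hleaf hne hM hc
  have hoff : ∀ e ∈ M.erase s(v, w), y ∉ e ∧ w ∉ e := by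
    intro e he
    have hw : w ∉ e := fun h => (Finset.mem_erase.mp he).1
      (hM.eq_of_mem (Finset.mem_erase.mp he).2 hmem h (by simp))
    refine ⟨fun h => ?_, hw⟩
    obtain ⟨z, rfl⟩ := Sym2.mem_iff_exists.mp h
    rw [hyleaf z (hM.1 _ (Finset.mem_erase.mp he).2)] at hw
    simp at hw
  have hM' : IsEdgeMatching T (insert s(y, w) (M.erase s(v, w))) := by
    have hE := hM.subset (Finset.erase_subset s(v, w) M)
    refine ⟨fun e he => ?_, fun e he f hf hef u hu => ?_⟩
    · rcases Finset.mem_insert.mp he with rfl | he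
      · exact hyw
      · exact hE.1 e he
    · rcases Finset.mem_insert.mp he with rfl | he₁ <;>
        rcases Finset.mem_insert.mp hf with rfl | hf₁
      · exact hef rfl
      · rcases Sym2.mem_iff.mp hu.1 with rfl | rfl
        · exact (hoff f hf₁).1 hu.2
        · exact (hoff f hf₁).2 hu.2
      · rcases Sym2.mem_iff.mp hu.2 with rfl | rfl
        · exact (hoff e he₁).1 hu.1
        · exact (hoff e he₁).2 hu.1
      · exact hE.2 e he₁ f hf₁ hef u hu
  have hc' : (insert s(y, w) (M.erase s(v, w))).card = matchingNumber T := by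
    rw [Finset.card_insert_of_notMem (fun h => (hoff _ h).1 (by simp)),
      Finset.card_erase_add_one hmem, hc]
  have := leaf_edge_mem_of_matchingNumber_ne hleaf hne hM' hc'
  rcases Finset.mem_insert.mp this with h | h
  · exact hyv (Sym2.congr_left.mp h).symm
  · exact (Finset.mem_erase.mp h).1 rfl

universe u

lemma harary_le_hararyBound_aux (N : ℕ) : ∀ {V : Type u} [Fintype V] (T : SimpleGraph V),
    Fintype.card V = N → T.IsTree → 1 ≤ matchingNumber T →
    harary T ≤ hararyBound N (matchingNumber T) ∧
      (harary T = hararyBound N (matchingNumber T) →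
        ∃ c, matchingNumber T + (nbrs T c).card = N) := by
  classical
  induction N using Nat.strong_induction_on with
  | _ N ih =>
  intro V _ T hN hT hβ
  by_cases hN3 : N < 3
  · obtain ⟨a, b, hab⟩ := exists_adj_of_matchingNumber_pos hβ
    have h1 : 1 ≤ (nbrs T a).card := Finset.card_pos.mpr ⟨b, by simpa using hab⟩
    have h2 := matchingNumber_add_card_nbrs_le hT.isAcyclic a
    obtain rfl : N = 2 := by omega
    have hβ1 : matchingNumber T = 1 := by omega
    refine ⟨?_, fun _ => ⟨a, by omega⟩⟩
    have h3 := harary_le_card_mul hT.connected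
    rw [hN] at h3
    rw [hβ1, hararyBound]
    norm_num at h3 ⊢
    exact h3
  obtain ⟨v, w, x, hvw, hleaf, hwx, hxv, hdeep⟩ := hT.exists_deep_leaf (by omega)
  have hT₁ := hT.induce_compl_leaf hvw hleaf
  have hcard₁ := card_induce_compl_singleton v
  have hH₁ := harary_eq_harary_induce_add hT hT₁.connected
  by_cases hβ₁ : matchingNumber (T.induce {v}ᶜ) = matchingNumber T
  · obtain ⟨hle, -⟩ := ih (N - 1) (by omega) (T.induce {v}ᶜ) (by omega) hT₁ (by omega)
    have hs := sum_one_div_dist_leaf_le hT.connected hvw hleaf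
    have hd := matchingNumber_add_card_nbrs_le hT.isAcyclic w
    rw [hβ₁, Nat.cast_sub (by omega : 1 ≤ N), hararyBound] at hle
    rw [hN] at hs hd
    have hd' : (matchingNumber T : ℝ) + ((nbrs T w).card : ℝ) ≤ N := by exact_mod_cast hd
    rw [hararyBound]
    push_cast at hle
    refine ⟨by linarith, fun heq => ⟨w, ?_⟩⟩
    have : (N : ℝ) ≤ (matchingNumber T : ℝ) + ((nbrs T w).card : ℝ) := by linarith
    exact le_antisymm hd (by exact_mod_cast this)
  · have hwnbrs : ∀ z, T.Adj w z → z = v ∨ z = x := by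
      intro z hz
      by_contra! h
      exact h.1 (leaf_unique_of_matchingNumber_ne hvw hleaf hβ₁ hz.symm (hdeep z hz h.2))
    have hle₁ := matchingNumber_le_of_embedding (Embedding.induce (G := T) ({v}ᶜ : Set V))
    have hpos₁ := (IsEdgeMatching.singleton hwx).card_le_of_range
      (Embedding.induce (G := T) ({v}ᶜ : Set V)) (by
        intro e he z hz
        rw [Finset.mem_singleton.mp he] at hz
        rcases Sym2.mem_iff.mp hz with rfl | rfl
        · exact ⟨⟨z, hvw.ne'⟩, rfl⟩
        · exact ⟨⟨z, hxv⟩, rfl⟩)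
    rw [Finset.card_singleton] at hpos₁
    have hwv : w ∈ ({v}ᶜ : Set V) := hvw.ne'
    have hwx₁ : (T.induce {v}ᶜ).Adj ⟨w, hwv⟩ ⟨x, hxv⟩ := by simpa using hwx
    have hleaf₁ : ∀ z, (T.induce {v}ᶜ).Adj ⟨w, hwv⟩ z → z = ⟨x, hxv⟩ := by
      rintro ⟨z, hz⟩ hadj
      exact Subtype.ext ((hwnbrs z (by simpa using hadj)).resolve_left hz)
    have hT₂ := hT₁.induce_compl_leaf hwx₁ hleaf₁
    have hcard₂ := card_induce_compl_singleton (⟨w, hwv⟩ : ({v}ᶜ : Set V))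
    have hH₂ := harary_eq_harary_induce_add hT₁ hT₂.connected
    let ι := (Embedding.induce (G := T) ({v}ᶜ : Set V)).comp
      (Embedding.induce (G := T.induce {v}ᶜ) ({⟨w, hwv⟩}ᶜ : Set ({v}ᶜ : Set V)))
    have hle₂ := matchingNumber_le_of_embedding
      (Embedding.induce (G := T.induce {v}ᶜ) ({⟨w, hwv⟩}ᶜ : Set ({v}ᶜ : Set V)))
    obtain ⟨M, hM, hMc⟩ := exists_isEdgeMatching_card_eq T
    have hmem := leaf_edge_mem_of_matchingNumber_ne hleaf hβ₁ hM hMc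
    have hge₂ := (hM.subset (Finset.erase_subset s(v, w) M)).card_le_of_range ι (by
      intro e he z hz
      have hoff : z ∉ s(v, w) := fun h => (Finset.mem_erase.mp he).1
        (hM.eq_of_mem (Finset.mem_erase.mp he).2 hmem hz h)
      simp only [Sym2.mem_iff, not_or] at hoff
      exact ⟨⟨⟨z, hoff.1⟩, fun h => hoff.2 (congrArg Subtype.val h)⟩, rfl⟩)
    rw [Finset.card_erase_of_mem hmem, hMc] at hge₂
    have hβ₂ : matchingNumber ((T.induce {v}ᶜ).induce {⟨w, hwv⟩}ᶜ) = matchingNumber T - 1 := by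
      omega
    have hcard : Fintype.card ({⟨w, hwv⟩}ᶜ : Set ({v}ᶜ : Set V)) = N - 2 := by
      rw [← hN, ← hcard₁, ← hcard₂]
      rfl
    obtain ⟨hle, -⟩ := ih (N - 2) (by omega) ((T.induce {v}ᶜ).induce {⟨w, hwv⟩}ᶜ) hcard hT₂
      (by omega)
    have hs₁ := sum_one_div_dist_pendent_path_le hT.connected hvw hleaf hwx hxv hwnbrs
    have hs₂ := sum_one_div_dist_leaf_le hT₁.connected hwx₁ hleaf₁
    have hd := matchingNumber_add_card_nbrs_le hT.isAcyclic x
    rw [card_nbrs_induce hleaf hxv hwx.ne'] at hs₂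
    rw [hβ₂, Nat.cast_sub (by omega : 2 ≤ N), Nat.cast_sub hβ, hararyBound] at hle
    rw [hN] at hs₁ hd hcard₁
    have hcard' : (Fintype.card ({v}ᶜ : Set V) : ℝ) + 1 = N := by exact_mod_cast hcard₁
    have hd' : (matchingNumber T : ℝ) + ((nbrs T x).card : ℝ) ≤ N := by exact_mod_cast hd
    rw [hararyBound]
    push_cast at hle
    refine ⟨by linarith, fun heq => ⟨x, ?_⟩⟩
    have : (N : ℝ) ≤ (matchingNumber T : ℝ) + ((nbrs T x).card : ℝ) := by linarith
    exact le_antisymm hd (by exact_mod_cast this)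

end Bound

section Spider

variable {k : ℕ} (L : Fin k → ℕ)

lemma spider_adj_center {i : Fin k} {j : Fin (L i)} (hj : (j : ℕ) = 0) :
    (spider L).Adj none (some ⟨i, j⟩) :=
  (fromRel_adj _ _ _).mpr ⟨by simp, Or.inl (Or.inl ⟨i, j, rfl, rfl, hj⟩)⟩

lemma spider_adj_leg {i : Fin k} {j j' : Fin (L i)} (hj : (j' : ℕ) = j + 1) :
    (spider L).Adj (some ⟨i, j⟩) (some ⟨i, j'⟩) := by
  refine (fromRel_adj _ _ _).mpr ⟨?_, Or.inl (Or.inr ⟨i, j, j', rfl, rfl, hj⟩)⟩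
  intro h
  simp only [Option.some.injEq, Sigma.mk.injEq, heq_eq_eq, true_and] at h
  rw [h] at hj
  omega

lemma spider_exists_walk (i : Fin k) (j : ℕ) (hj : j < L i) :
    ∃ p : (spider L).Walk none (some ⟨i, ⟨j, hj⟩⟩), p.length = j + 1 := by
  induction j with
  | zero => exact ⟨(spider_adj_center L rfl).toWalk, rfl⟩
  | succ j ih =>
    obtain ⟨p, hp⟩ := ih (by omega)
    exact ⟨p.concat (spider_adj_leg L rfl), by rw [Walk.length_concat, hp]⟩

lemma spider_connected : (spider L).Connected := by
  refine (connected_iff_exists_forall_reachable _).mpr ⟨none, ?_⟩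
  rintro (_ | ⟨i, j, hj⟩)
  · rfl
  · exact ⟨(spider_exists_walk L i j hj).choose⟩

lemma spider_dist_center_le (i : Fin k) (j : Fin (L i)) :
    (spider L).dist none (some ⟨i, j⟩) ≤ j + 1 := by
  obtain ⟨p, hp⟩ := spider_exists_walk L i j j.2
  exact hp ▸ dist_le p

lemma spider_dist_le (i i' : Fin k) (j : Fin (L i)) (j' : Fin (L i')) :
    (spider L).dist (some ⟨i, j⟩) (some ⟨i', j'⟩) ≤ j + j' + 2 := by
  have h := (spider_connected L).dist_triangle (u := some ⟨i, j⟩) (v := none) (w := some ⟨i', j'⟩)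
  have h₁ := spider_dist_center_le L i j
  have h₂ := spider_dist_center_le L i' j'
  rw [dist_comm] at h₁
  omega

end Spider

section Spur

variable {n m : ℕ}

lemma sum_spurLegs_eq (F : ℕ → ℝ) (i : Fin m) :
    ∑ j : Fin (spurLegs n m i), F j = F 0 + (if (i : ℕ) < n - m - 1 then 1 else 0) * F 1 := by
  rw [Fin.sum_univ_eq_sum_range F]
  unfold spurLegs
  split_ifs <;> simp [Finset.sum_range_succ]

lemma sum_spur_indicator (h : n - m - 1 ≤ m) :
    ∑ i : Fin m, (if (i : ℕ) < n - m - 1 then (1 : ℝ) else 0) = (n - m - 1 : ℕ) := by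
  rw [Fin.sum_univ_eq_sum_range (fun i => if i < n - m - 1 then (1 : ℝ) else 0),
    Finset.sum_ite, Finset.sum_const_zero, add_zero, Finset.sum_const, nsmul_eq_mul, mul_one]
  congr 1
  have : (Finset.range m).filter (· < n - m - 1) = Finset.range (n - m - 1) := by
    ext x
    simp only [Finset.mem_filter, Finset.mem_range]
    omega
  rw [this, Finset.card_range]

lemma spur_one_div_dist_center_ge (i : Fin m) (j : Fin (spurLegs n m i)) :
    (1 : ℝ) / ((j : ℕ) + 1) ≤ 1 / ((spur n m).dist none (some ⟨i, j⟩)) := by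
  have hpos : (0 : ℝ) < (spur n m).dist none (some ⟨i, j⟩) := by
    exact_mod_cast (spider_connected (spurLegs n m)).pos_dist_of_ne (by simp)
  refine one_div_le_one_div_of_le hpos ?_
  exact_mod_cast spider_dist_center_le (spurLegs n m) i j

lemma spur_one_div_dist_ge (i i' : Fin m) (j : Fin (spurLegs n m i))
    (j' : Fin (spurLegs n m i')) :
    (if i' = i then (if (j' : ℕ) = j then 0 else 1) else (1 : ℝ) / ((j : ℕ) + (j' : ℕ) + 2)) ≤
      1 / ((spur n m).dist (some ⟨i, j⟩) (some ⟨i', j'⟩)) := by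
  split_ifs with hi hj
  · positivity
  · subst hi
    have h2 : spurLegs n m i' ≤ 2 := by
      unfold spurLegs
      split_ifs <;> omega
    have hadj : (spur n m).Adj (some ⟨i', j⟩) (some ⟨i', j'⟩) := by
      have h₁ := j.2
      have h₂ := j'.2
      rcases (by omega : (j' : ℕ) = j + 1 ∨ (j : ℕ) = j' + 1) with h | h
      · exact spider_adj_leg _ h
      · exact (spider_adj_leg _ h).symm
    rw [dist_eq_one_iff_adj.mpr hadj]
    norm_num
  · have hne : (some ⟨i, j⟩ : Option (Σ i : Fin m, Fin (spurLegs n m i))) ≠ some ⟨i', j'⟩ := by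
      intro h
      simp only [Option.some.injEq, Sigma.mk.injEq] at h
      exact hi h.1.symm
    have hpos : (0 : ℝ) < (spur n m).dist (some ⟨i, j⟩) (some ⟨i', j'⟩) := by
      exact_mod_cast (spider_connected (spurLegs n m)).pos_dist_of_ne hne
    refine one_div_le_one_div_of_le hpos ?_
    exact_mod_cast spider_dist_le (spurLegs n m) i i' j j'

lemma harary_spur_ge (h : n - m - 1 ≤ m) :
    ((m : ℝ) ^ 2 / 2 + 2 * m * (n - m - 1 : ℕ) / 3 + ((n - m - 1 : ℕ) : ℝ) ^ 2 / 4 +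
      25 * (n - m - 1 : ℕ) / 12 + 3 * m / 2) / 2 ≤ harary (spur n m) := by
  set a : Fin m → ℝ := fun i => if (i : ℕ) < n - m - 1 then 1 else 0 with ha
  have hsum : ∑ i, a i = (n - m - 1 : ℕ) := sum_spur_indicator h
  have hcenter : (m : ℝ) + (n - m - 1 : ℕ) / 2 ≤
      ∑ x : Σ i : Fin m, Fin (spurLegs n m i), (1 : ℝ) / ((spur n m).dist none (some x)) := by
    calc (m : ℝ) + (n - m - 1 : ℕ) / 2 = ∑ i, (1 + a i * (1 / 2)) := by
          rw [Finset.sum_add_distrib, ← Finset.sum_mul, hsum]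
          simp
          ring
      _ = ∑ i : Fin m, ∑ j : Fin (spurLegs n m i), (1 : ℝ) / ((j : ℕ) + 1) := by
          refine Finset.sum_congr rfl fun i _ => ?_
          rw [sum_spurLegs_eq (fun j => (1 : ℝ) / ((j : ℕ) + 1))]
          norm_num [ha]
      _ ≤ _ := by
          rw [Fintype.sum_sigma]
          exact Finset.sum_le_sum fun i _ => Finset.sum_le_sum fun j _ =>
            spur_one_div_dist_center_ge i j
  have hlegs : (m : ℝ) ^ 2 / 2 + 2 * m * (n - m - 1 : ℕ) / 3 + ((n - m - 1 : ℕ) : ℝ) ^ 2 / 4 +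
      13 * (n - m - 1 : ℕ) / 12 - m / 2 ≤
      ∑ x : Σ i : Fin m, Fin (spurLegs n m i), ∑ y : Σ i : Fin m, Fin (spurLegs n m i),
        (1 : ℝ) / ((spur n m).dist (some x) (some y)) := by
    calc _ = ∑ i, ∑ i', (1 / 2 + (1 / 3) * a i + (1 / 3) * a i' + (1 / 4) * (a i * a i') +
            if i' = i then 13 / 12 * a i - 1 / 2 else 0) := by
          simp only [Finset.sum_add_distrib, ← Finset.mul_sum, Finset.sum_ite_eq', mem_univ,
            if_true, Finset.sum_const, card_univ, Fintype.card_fin, nsmul_eq_mul,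
            Finset.sum_sub_distrib, ← Finset.sum_mul, hsum]
          ring
      _ = ∑ i : Fin m, ∑ i' : Fin m, ∑ j : Fin (spurLegs n m i), ∑ j' : Fin (spurLegs n m i'),
            (if i' = i then (if (j' : ℕ) = j then 0 else 1)
              else (1 : ℝ) / ((j : ℕ) + (j' : ℕ) + 2)) := by
          refine Finset.sum_congr rfl fun i _ => Finset.sum_congr rfl fun i' _ => ?_
          have hin : ∀ j : Fin (spurLegs n m i), _ := fun j => sum_spurLegs_eq (n := n) (fun j' =>
            if i' = i then (if j' = (j : ℕ) then 0 else 1)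
              else (1 : ℝ) / ((j : ℕ) + (j' : ℕ) + 2)) i'
          simp only [hin]
          rw [sum_spurLegs_eq (n := n) (fun j => (if i' = i then (if 0 = j then 0 else 1)
              else (1 : ℝ) / ((j : ℕ) + ((0 : ℕ) : ℝ) + 2)) +
            (if (i' : ℕ) < n - m - 1 then 1 else 0) * (if i' = i then (if 1 = j then 0 else 1)
              else (1 : ℝ) / ((j : ℕ) + ((1 : ℕ) : ℝ) + 2))) i]
          simp only [ha]
          by_cases hi : i' = i
          · subst hi
            by_cases hk : (i' : ℕ) < n - m - 1
            · norm_num [hk]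
            · norm_num [hk]
          · simp only [hi, if_false]
            split_ifs <;> norm_num
      _ ≤ _ := by
          rw [Fintype.sum_sigma]
          refine Finset.sum_le_sum fun i _ => ?_
          rw [Finset.sum_comm]
          refine Finset.sum_le_sum fun j _ => ?_
          rw [Fintype.sum_sigma]
          exact Finset.sum_le_sum fun i' _ => Finset.sum_le_sum fun j' _ =>
            spur_one_div_dist_ge i i' j j'
  rw [harary_eq_sum, Fintype.sum_option]
  simp only [Fintype.sum_option, Finset.sum_add_distrib, dist_comm (v := none), SimpleGraph.dist_self]
  simp only [Nat.cast_zero, div_zero]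
  linarith

lemma SimpleGraph.Iso.dist_le {V W : Type*} {G : SimpleGraph V} {H : SimpleGraph W} (f : G ≃g H)
    (hH : H.Connected) (a b : V) : G.dist a b ≤ H.dist (f a) (f b) := by
  obtain ⟨p, hp⟩ := hH.exists_walk_length_eq_dist (f a) (f b)
  have h := SimpleGraph.dist_le (p.map f.symm.toHom)
  rw [Walk.length_map, hp] at h
  simpa using h

lemma SimpleGraph.Iso.harary_ge {V W : Type*} [Fintype V] [Fintype W] {G : SimpleGraph V}
    {H : SimpleGraph W} (f : G ≃g H) (hH : H.Connected) : harary H ≤ harary G := by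
  rw [harary_eq_sum, harary_eq_sum, ← f.toEquiv.sum_comp]
  refine div_le_div_of_nonneg_right (Finset.sum_le_sum fun a _ => ?_) (by norm_num)
  rw [← f.toEquiv.sum_comp]
  refine Finset.sum_le_sum fun b _ => ?_
  by_cases hab : a = b
  · simp [hab]
  · have hpos : (0 : ℝ) < G.dist a b := by
      exact_mod_cast (f.connected_iff.mpr hH).pos_dist_of_ne hab
    exact one_div_le_one_div_of_le hpos (by exact_mod_cast f.dist_le hH a b)

lemma nonempty_iso_spur {V : Type*} [Fintype V] {T : SimpleGraph V} (hT : T.IsTree) {c : V}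
    (hcard : Fintype.card V = n) (hm : (nbrs T c).card = m) (hle : n - m - 1 ≤ m)
    (hc : matchingNumber T + m = n) : Nonempty (T ≃g spur n m) := by
  classical
  obtain ⟨p, hp, hpinj⟩ := exists_partner_of_card_nbrs hT.isAcyclic (c := c) (by omega)
  have hcardFar : Fintype.card {y // y ∈ (nbrs T c)ᶜ.erase c} = n - m - 1 := by
    rw [Fintype.card_coe, Finset.card_erase_of_mem (by simp), Finset.card_compl, hm, hcard]
  have hcardIdx : Fintype.card {i : Fin m // (i : ℕ) < n - m - 1} = n - m - 1 := by
    have h := sum_spur_indicator hle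
    rw [Finset.sum_boole] at h
    rw [Fintype.card_subtype]
    exact_mod_cast h
  obtain ⟨q⟩ := Fintype.card_eq.mp (hcardIdx.trans hcardFar.symm)
  obtain ⟨e₀⟩ : Nonempty (Fin m ≃ {z // z ∈ nbrs T c}) :=
    Fintype.card_eq.mp (by rw [Fintype.card_fin, Fintype.card_coe, hm])
  have hq : ∀ i, (q i : V) ≠ c ∧ ¬ T.Adj c (q i) := by
    intro i
    have h := (q i).2
    rw [Finset.mem_erase, Finset.mem_compl, mem_nbrs] at h
    exact h
  let s : {i : Fin m // (i : ℕ) < n - m - 1} → Fin m := fun i =>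
    e₀.symm ⟨p (q i), by simpa using (hp _ (hq i).2).2⟩
  have hs : Function.Injective s := by
    intro i i' h
    have h := congrArg Subtype.val (e₀.symm.injective h)
    exact q.injective (Subtype.ext (hpinj _ _ (hq i).2 (hq i').2 h))
  let σ : Equiv.Perm (Fin m) := (Equiv.ofInjective s hs).extendSubtype
  have hσ : ∀ (i : Fin m) (h : (i : ℕ) < n - m - 1), (e₀ (σ i) : V) = p (q ⟨i, h⟩) := by
    intro i h
    have : σ i = s ⟨i, h⟩ := (Equiv.ofInjective s hs).extendSubtype_apply_of_mem i h
    rw [this]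
    simp [s]
  have he : ∀ i, T.Adj c (e₀ (σ i)) := fun i => mem_nbrs.mp (e₀ (σ i)).2
  have hleg : ∀ (i : Fin m) (j : Fin (spurLegs n m i)), (j : ℕ) ≠ 0 →
      (i : ℕ) < n - m - 1 ∧ (j : ℕ) = 1 := by
    intro i j hj
    have h := j.2
    unfold spurLegs at h
    split_ifs at h with h' <;> omega
  let f : Option (Σ i : Fin m, Fin (spurLegs n m i)) → V
    | none => c
    | some ⟨i, j⟩ => if h : (j : ℕ) = 0 then e₀ (σ i) else q ⟨i, (hleg i j h).1⟩
  have hf₀ : ∀ (i : Fin m) (j : Fin (spurLegs n m i)), (j : ℕ) = 0 →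
      f (some ⟨i, j⟩) = e₀ (σ i) := fun i j h => dif_pos h
  have hf₁ : ∀ (i : Fin m) (j : Fin (spurLegs n m i)) (h : (j : ℕ) ≠ 0),
      f (some ⟨i, j⟩) = q ⟨i, (hleg i j h).1⟩ := fun i j h => dif_neg h
  have hinj : Function.Injective f := by
    have hnone : ∀ x, f none ≠ f (some x) := by
      rintro ⟨i, j⟩ h
      by_cases hj : (j : ℕ) = 0
      · rw [hf₀ i j hj] at h
        exact (he i).ne h
      · rw [hf₁ i j hj] at h
        exact (hq _).1 h.symm
    rintro (_ | ⟨i, j⟩) (_ | ⟨i', j'⟩) h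
    · rfl
    · exact absurd h (hnone ⟨i', j'⟩)
    · exact absurd h.symm (hnone ⟨i, j⟩)
    · have hii : i = i' ∧ (j : ℕ) = j' := by
        by_cases hj : (j : ℕ) = 0 <;> by_cases hj' : (j' : ℕ) = 0
        · rw [hf₀ i j hj, hf₀ i' j' hj'] at h
          exact ⟨σ.injective (e₀.injective (Subtype.ext h)), by omega⟩
        · rw [hf₀ i j hj, hf₁ i' j' hj'] at h
          exact absurd (h ▸ he i) (hq _).2
        · rw [hf₁ i j hj, hf₀ i' j' hj'] at h
          exact absurd (h ▸ he i') (hq _).2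
        · rw [hf₁ i j hj, hf₁ i' j' hj'] at h
          have h₁ := (hleg i j hj).2
          have h₂ := (hleg i' j' hj').2
          exact ⟨congrArg Subtype.val (q.injective (Subtype.ext h)), by omega⟩
      obtain ⟨rfl, hj⟩ := hii
      rw [Fin.ext hj]
  have hsurj : Function.Surjective f := by
    intro y
    by_cases hyc : y = c
    · exact ⟨none, hyc.symm⟩
    by_cases hadj : T.Adj c y
    · refine ⟨some ⟨σ.symm (e₀.symm ⟨y, by simpa using hadj⟩), ⟨0, ?_⟩⟩, ?_⟩
      · unfold spurLegs
        split_ifs <;> omega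
      · rw [hf₀ _ _ rfl]
        simp
    · have hy : y ∈ (nbrs T c)ᶜ.erase c := by simp [hyc, hadj]
      refine ⟨some ⟨(q.symm ⟨y, hy⟩).1, ⟨1, ?_⟩⟩, ?_⟩
      · unfold spurLegs
        rw [if_pos (q.symm ⟨y, hy⟩).2]
        omega
      · rw [hf₁ _ _ (by simp)]
        simp
  let E := Equiv.ofBijective f ⟨hinj, hsurj⟩
  have hrel : ∀ x y, ((∃ (i : Fin m) (j : Fin (spurLegs n m i)),
        x = none ∧ y = some ⟨i, j⟩ ∧ (j : ℕ) = 0) ∨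
      (∃ (i : Fin m) (j j' : Fin (spurLegs n m i)),
        x = some ⟨i, j⟩ ∧ y = some ⟨i, j'⟩ ∧ (j' : ℕ) = (j : ℕ) + 1)) → T.Adj (f x) (f y) := by
    rintro x y (⟨i, j, rfl, rfl, hj⟩ | ⟨i, j, j', rfl, rfl, hj⟩)
    · rw [hf₀ i j hj]
      exact he i
    · have hj' := hleg i j' (by omega)
      rw [hf₀ i j (by omega), hf₁ i j' (by omega), hσ i hj'.1]
      exact (hp _ (hq _).2).1.symm
  have hspur : spur n m ≤ T.comap E := by
    intro x y hxy
    rcases ((fromRel_adj _ _ _).mp hxy).2 with h | h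
    · exact hrel x y h
    · exact (hrel y x h).symm
  have htree : (T.comap E).IsTree := (Iso.comap E T).isTree_iff.mpr hT
  have heq : spur n m = T.comap E := le_antisymm hspur
    ((isTree_iff_minimal_connected.mp htree).2 (spider_connected (spurLegs n m)) hspur)
  rw [heq]
  exact ⟨(Iso.comap E T).symm⟩

end Spur

theorem harary_matching_number_bound {V : Type*} [Fintype V] (T : SimpleGraph V)
    (hT : T.IsTree) (n β : ℕ) (hcard : Fintype.card V = n)
    (hβ : matchingNumber T = β) (hβ1 : 1 ≤ β) (hβ2 : β ≤ n / 2) :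
    harary T ≤ (6 * (n : ℝ) ^ 2 - 4 * (β : ℝ) * (n : ℝ) + (β : ℝ) ^ 2 + 9 * (β : ℝ) +
      10 * (n : ℝ) - 22) / 24 ∧
    (harary T = (6 * (n : ℝ) ^ 2 - 4 * (β : ℝ) * (n : ℝ) + (β : ℝ) ^ 2 + 9 * (β : ℝ) +
      10 * (n : ℝ) - 22) / 24 ↔ Nonempty (T ≃g spur n (n - β))) := by
  have hmain := harary_le_hararyBound_aux n T hcard hT (by omega)
  simp only [hβ, hararyBound] at hmain
  refine ⟨hmain.1, fun heq => ?_, fun ⟨f⟩ => le_antisymm hmain.1 ?_⟩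
  · obtain ⟨c, hc⟩ := hmain.2 heq
    exact nonempty_iso_spur hT hcard (c := c) (by omega) (by omega) (by omega)
  · refine le_trans (le_of_eq ?_) ((harary_spur_ge (n := n) (m := n - β) (by omega)).trans
      (f.harary_ge (spider_connected _)))
    have hk : n - (n - β) - 1 = β - 1 := by omega
    rw [hk, Nat.cast_sub hβ1, Nat.cast_sub (by omega : β ≤ n)]
    push_cast
    ring
end

section
/- Let n be even and let T be a tree on n vertices possessing a perfect matching. Then H(T) ≤ (17n² + 58n − 88)/96, with equality if and only if T is isomorphic to the spur A_{n,n/2}. -/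
open Finset SimpleGraph

namespace SimpleGraph

section TreeDistance

variable {V : Type*} {T : SimpleGraph V}

/-- In a tree, at most one neighbour of `b` is closer to `x` than `b` is. -/
theorem IsTree.eq_of_adj_of_dist_lt (hT : T.IsTree) {x a b b' : V} (ha : T.Adj a b)
    (hb : T.Adj b' b) (hxa : T.dist x a < T.dist x b) (hxb : T.dist x b' < T.dist x b) :
    a = b' := by
  classical
  obtain ⟨p, hp, hpl⟩ := hT.connected.exists_path_of_dist x a
  obtain ⟨q, hq, hql⟩ := hT.connected.exists_path_of_dist x b'
  have hbp : b ∉ p.support := fun h => by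
    have h₁ := dist_le (p.takeUntil b h)
    have h₂ := p.length_takeUntil_le_length h
    omega
  have hbq : b ∉ q.support := fun h => by
    have h₁ := dist_le (q.takeUntil b h)
    have h₂ := q.length_takeUntil_le_length h
    omega
  have h := (hT.isAcyclic.subsingleton_path x b).elim
    ⟨p.concat ha, hp.concat hbp ha⟩ ⟨q.concat hb, hq.concat hbq hb⟩
  exact (Walk.concat_inj (congrArg Subtype.val h)).1

theorem IsTree.dist_eq_add_one_of_dist_lt (hT : T.IsTree) {x a b b' : V} (ha : T.Adj a b)
    (hb : T.Adj b' b) (hne : a ≠ b') (hxa : T.dist x a < T.dist x b) :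
    T.dist x b' = T.dist x b + 1 := by
  rcases hT.dist_eq_dist_add_one_of_adj x hb with h | h
  · exact h
  · exact absurd (hT.eq_of_adj_of_dist_lt ha hb hxa (by omega)) hne

theorem Connected.exists_adj_dist_add_one (hT : T.Connected) {x b : V} (hne : x ≠ b) :
    ∃ w, T.Adj w b ∧ T.dist x w + 1 = T.dist x b := by
  obtain ⟨p, hp⟩ := hT.exists_walk_length_eq_dist b x
  cases p with
  | nil => exact absurd rfl hne
  | @cons _ w _ h q =>
    refine ⟨w, h.symm, ?_⟩
    have h₁ := dist_le q
    have h₂ := hT.dist_triangle (u := x) (v := w) (w := b)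
    have h₃ := dist_eq_one_iff_adj.2 h.symm
    rw [Walk.length_cons, dist_comm] at hp
    rw [dist_comm] at h₁
    omega

/-- If two distinct edges `aa'` and `bb'` of a tree are such that `a` and `b` are closer to each
other than to the opposite ends, then the far ends are joined through `a` and `b`. -/
theorem IsTree.dist_far_ends (hT : T.IsTree) {a a' b b' : V} (ha : T.Adj a a') (hb : T.Adj b b')
    (hne : a' ≠ b') (h₁ : T.dist a b' = T.dist a b + 1) (h₂ : T.dist a' b = T.dist a b + 1) :
    T.dist a' b' = T.dist a b + 2 := by
  by_cases hab : a = b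
  · subst hab
    have h := hT.dist_eq_add_one_of_dist_lt (x := a') ha.symm hb.symm hne
      (by rw [dist_self]; simpa using h₂ ▸ Nat.succ_pos _)
    omega
  · obtain ⟨w, hw, hd⟩ := hT.connected.exists_adj_dist_add_one hab
    have hwb : w ≠ b' := fun h => by subst h; omega
    have h₃ := hT.connected.dist_triangle (u := a') (v := w) (w := b)
    have h₄ := dist_eq_one_iff_adj.2 hw
    have h₅ := hT.dist_eq_dist_add_one_of_adj w ha
    rw [dist_comm (u := w), dist_comm (u := w)] at h₅
    have h := hT.dist_eq_add_one_of_dist_lt (x := a') hw hb.symm hwb (by omega)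
    omega

/-- The four distances between the ends of two disjoint edges of a tree are
`t`, `t + 1`, `t + 1`, `t + 2`. -/
theorem IsTree.dist_disjoint_edges (hT : T.IsTree) {a a' b b' : V} (ha : T.Adj a a')
    (hb : T.Adj b b') (h₁ : a ≠ b) (h₂ : a ≠ b') (h₃ : a' ≠ b) (h₄ : a' ≠ b') :
    ∃ t, 1 ≤ t ∧
      ((T.dist a b = t ∧ T.dist a b' = t + 1 ∧ T.dist a' b = t + 1 ∧ T.dist a' b' = t + 2) ∨
       (T.dist a b' = t ∧ T.dist a b = t + 1 ∧ T.dist a' b' = t + 1 ∧ T.dist a' b = t + 2) ∨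
       (T.dist a' b = t ∧ T.dist a' b' = t + 1 ∧ T.dist a b = t + 1 ∧ T.dist a b' = t + 2) ∨
       (T.dist a' b' = t ∧ T.dist a' b = t + 1 ∧ T.dist a b' = t + 1 ∧ T.dist a b = t + 2)) := by
  have e₁ := hT.dist_eq_dist_add_one_of_adj a hb
  have e₂ := hT.dist_eq_dist_add_one_of_adj a' hb
  have e₃ := hT.dist_eq_dist_add_one_of_adj b ha
  have e₄ := hT.dist_eq_dist_add_one_of_adj b' ha
  simp only [dist_comm (u := b), dist_comm (u := b')] at e₃ e₄
  have p₁ := hT.connected.pos_dist_of_ne h₁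
  have p₂ := hT.connected.pos_dist_of_ne h₂
  have p₃ := hT.connected.pos_dist_of_ne h₃
  have p₄ := hT.connected.pos_dist_of_ne h₄
  have f₁ := hT.dist_far_ends ha hb h₄
  have f₂ := hT.dist_far_ends ha hb.symm h₃
  rcases e₁ with e₁ | e₁ <;> rcases e₃ with e₃ | e₃
  · have h : T.dist a' b' ≠ T.dist a b' + 1 := fun h => by
      have := f₂ e₁ h
      omega
    exact ⟨T.dist a' b', p₄, by omega⟩
  · exact ⟨T.dist a b', p₂, by omega⟩
  · exact ⟨T.dist a' b, p₃, by omega⟩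
  · have h := f₁ e₁ e₃
    exact ⟨T.dist a b, p₁, by omega⟩

end TreeDistance

section Matching

variable {V : Type*} {T : SimpleGraph V}

theorem Subgraph.IsPerfectMatching.exists_involutive {M : T.Subgraph} (hM : M.IsPerfectMatching) :
    ∃ σ : V → V, Function.Involutive σ ∧ ∀ v, T.Adj v (σ v) := by
  rw [Subgraph.isPerfectMatching_iff] at hM
  choose σ hσ huniq using hM
  exact ⟨σ, fun v => (huniq (σ v) v (hσ v).symm).symm, fun v => (hσ v).adj_sub⟩

/-- Any two edges of the matching `σ` are at distance at most `2`. -/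
def MatchingClose (T : SimpleGraph V) (σ : V → V) : Prop :=
  ∀ u v, T.dist u v ≤ 2 ∨ T.dist u (σ v) ≤ 2 ∨ T.dist (σ u) v ≤ 2 ∨ T.dist (σ u) (σ v) ≤ 2

/-- Every edge of the matching `σ` has an end adjacent to `c`. -/
def IsMatchingCenter (T : SimpleGraph V) (σ : V → V) (c : V) : Prop :=
  ∀ x, T.Adj c x ∨ T.Adj c (σ x)

variable {σ : V → V}

theorem IsMatchingCenter.matchingClose (hT : T.IsTree) {c : V} (hc : T.IsMatchingCenter σ c) :
    T.MatchingClose σ := by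
  have key : ∀ x y, T.Adj c x → T.Adj c y → T.dist x y ≤ 2 := fun x y hx hy => by
    have h := hT.connected.dist_triangle (u := x) (v := c) (w := y)
    rw [dist_eq_one_iff_adj.2 hx.symm, dist_eq_one_iff_adj.2 hy] at h
    exact h
  intro u v
  rcases hc u with hu | hu <;> rcases hc v with hv | hv
  · exact Or.inl (key _ _ hu hv)
  · exact Or.inr (Or.inl (key _ _ hu hv))
  · exact Or.inr (Or.inr (Or.inl (key _ _ hu hv)))
  · exact Or.inr (Or.inr (Or.inr (key _ _ hu hv)))

/-- If no end of the matching edge at `x` is adjacent to `a`, and `ab` is an edge outside the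
matching, then some end `y` of that matching edge hangs at `b`. -/
theorem MatchingClose.exists_adj_of_not_adj (hT : T.IsTree) (hinv : Function.Involutive σ)
    (hσ : ∀ v, T.Adj v (σ v)) (hclose : T.MatchingClose σ) {a b x : V} (hab : T.Adj a b)
    (hne : b ≠ σ a) (h₁ : ¬ T.Adj a x) (h₂ : ¬ T.Adj a (σ x)) :
    ∃ y, T.Adj b y ∧ T.dist y a = 2 ∧ T.dist (σ y) b = 2 ∧ T.dist (σ y) a = 3 := by
  have hxa : x ≠ a := fun h => h₂ (h ▸ hσ x)
  have hsxa : σ x ≠ a := fun h => h₁ (h ▸ (hσ x).symm)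
  have hxb : x ≠ b := fun h => h₁ (h ▸ hab)
  have hsxb : σ x ≠ b := fun h => h₂ (h ▸ hab)
  have hneb : a ≠ σ b := fun h => hne (by rw [h, hinv])
  obtain ⟨y, hya, hyb, hsya, hsyb, ny, nsy, c⟩ : ∃ y, y ≠ a ∧ y ≠ b ∧ σ y ≠ a ∧ σ y ≠ b ∧
      T.dist y a ≠ 1 ∧ T.dist (σ y) a ≠ 1 ∧
      ((T.dist (σ y) a = T.dist y a + 1 ∧ T.dist y b = T.dist y a + 1 ∧
          T.dist (σ y) b = T.dist y a + 2) ∨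
       (T.dist (σ y) b = T.dist y b + 1 ∧ T.dist y a = T.dist y b + 1 ∧
          T.dist (σ y) a = T.dist y b + 2)) := by
    obtain ⟨t, -, h⟩ := hT.dist_disjoint_edges (hσ x) hab hxa hxb hsxa hsxb
    have n₁ : T.dist x a ≠ 1 := fun h => h₁ (dist_eq_one_iff_adj.1 h).symm
    have n₂ : T.dist (σ x) a ≠ 1 := fun h => h₂ (dist_eq_one_iff_adj.1 h).symm
    rcases h with h | h | h | h
    · exact ⟨x, hxa, hxb, hsxa, hsxb, n₁, n₂, by omega⟩
    · exact ⟨x, hxa, hxb, hsxa, hsxb, n₁, n₂, by omega⟩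
    · exact ⟨σ x, hsxa, hsxb, by rwa [hinv], by rwa [hinv], n₂, by rwa [hinv], by rw [hinv]; omega⟩
    · exact ⟨σ x, hsxa, hsxb, by rwa [hinv], by rwa [hinv], n₂, by rwa [hinv], by rw [hinv]; omega⟩
  have pya := hT.connected.pos_dist_of_ne hya
  have pyb := hT.connected.pos_dist_of_ne hyb
  rcases c with ⟨c₁, c₂, c₃⟩ | ⟨c₁, c₂, c₃⟩
  · have d₁ := hT.dist_eq_add_one_of_dist_lt (x := y) hab (hσ b).symm hneb (by omega)
    have d₂ := hT.dist_eq_add_one_of_dist_lt (x := σ y) hab (hσ b).symm hneb (by omega)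
    have := hclose y b
    omega
  · have d₁ := hT.dist_eq_add_one_of_dist_lt (x := y) hab.symm (hσ a).symm hne (by omega)
    have d₂ := hT.dist_eq_add_one_of_dist_lt (x := σ y) hab.symm (hσ a).symm hne (by omega)
    have := hclose y a
    have h : T.dist y b = 1 := by omega
    exact ⟨y, (dist_eq_one_iff_adj.1 h).symm, by omega, by omega, by omega⟩

theorem MatchingClose.exists_isMatchingCenter (hT : T.IsTree) (hinv : Function.Involutive σ)
    (hσ : ∀ v, T.Adj v (σ v)) (hclose : T.MatchingClose σ) : ∃ c, T.IsMatchingCenter σ c := by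
  by_cases hex : ∃ a b, T.Adj a b ∧ b ≠ σ a
  · obtain ⟨a, b, hab, hne⟩ := hex
    have hneb : a ≠ σ b := fun h => hne (by rw [h, hinv])
    by_contra! hno
    have ha := hno a
    have hb := hno b
    simp only [IsMatchingCenter, not_forall, not_or] at ha hb
    obtain ⟨x₀, hx₀, hx₀'⟩ := ha
    obtain ⟨y₀, hy₀, hy₀'⟩ := hb
    obtain ⟨x, hbx, hxa, hsxb, hsxa⟩ := hclose.exists_adj_of_not_adj hT hinv hσ hab hne hx₀ hx₀'
    obtain ⟨y, hay, hyb, hsya, hsyb⟩ :=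
      hclose.exists_adj_of_not_adj hT hinv hσ hab.symm hneb hy₀ hy₀'
    have hxb := dist_eq_one_iff_adj.2 hbx.symm
    have hby : b ≠ y := fun h => by rw [h, dist_self] at hyb; omega
    have hasy : a ≠ σ y := fun h => by rw [h, dist_self] at hsya; omega
    have d₁ := hT.dist_eq_add_one_of_dist_lt (x := x) hab.symm hay.symm hby (by omega)
    have d₂ := hT.dist_eq_add_one_of_dist_lt (x := σ x) hab.symm hay.symm hby (by omega)
    have d₃ := hT.dist_eq_add_one_of_dist_lt (x := x) hay (hσ y).symm hasy (by omega)
    have d₄ := hT.dist_eq_add_one_of_dist_lt (x := σ x) hay (hσ y).symm hasy (by omega)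
    have := hclose x y
    omega
  · push Not at hex
    obtain ⟨c⟩ := hT.connected.nonempty
    refine ⟨c, fun x => ?_⟩
    by_cases hx : x = c
    · exact Or.inr (hx ▸ hσ x)
    · left
      by_contra hcx
      obtain ⟨w, hw, hd⟩ := hT.connected.exists_adj_dist_add_one (Ne.symm hx)
      have hwc : c ≠ w := fun h => hcx (h ▸ hw)
      obtain ⟨z, hz, hd'⟩ := hT.connected.exists_adj_dist_add_one hwc
      have h₁ := hex w x hw
      have h₂ := hex w z hz.symm
      rw [h₁, ← h₂] at hd
      omega

end Matching

section Spur

variable {V : Type*} {T : SimpleGraph V} {σ : V → V}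

theorem spur_adj_none_of_adj {n : ℕ} {y z : Option (Σ i : Fin (n / 2), Fin (spurLegs n (n / 2) i))}
    (h : (spur n (n / 2)).Adj y z) :
    (spur n (n / 2)).Adj none y ∨ (spur n (n / 2)).Adj none z := by
  have key : ∀ (i : Fin (n / 2)) (j j' : Fin (spurLegs n (n / 2) i)), (j' : ℕ) = j + 1 →
      (spur n (n / 2)).Adj none (some ⟨i, j⟩) := by
    intro i j j' hj
    have hlt := j'.2
    have hle : spurLegs n (n / 2) i ≤ 2 := by unfold spurLegs; split <;> omega
    exact (fromRel_adj _ _ _).2 ⟨by simp, Or.inl (Or.inl ⟨i, j, rfl, rfl, by omega⟩)⟩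
  have h' := (fromRel_adj _ _ _).1 h
  rcases h'.2 with (⟨i, j, hy, -⟩ | ⟨i, j, j', hy, hz, hj⟩) | (⟨i, j, hz, -⟩ | ⟨i, j, j', hz, hy, hj⟩)
  · exact Or.inr (hy ▸ h)
  · exact Or.inl (hy ▸ key i j j' hj)
  · exact Or.inl (hz ▸ h.symm)
  · exact Or.inr (hz ▸ key i j j' hj)

theorem isMatchingCenter_of_iso_spur {n : ℕ} (hσ : ∀ v, T.Adj v (σ v))
    (φ : T ≃g spur n (n / 2)) : T.IsMatchingCenter σ (φ.symm none) := by
  intro x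
  have h := spur_adj_none_of_adj (φ.map_adj_iff.2 (hσ x))
  rwa [← φ.symm.map_adj_iff, ← φ.symm.map_adj_iff, RelIso.symm_apply_apply,
    RelIso.symm_apply_apply] at h

variable [Fintype V]

theorem IsMatchingCenter.two_mul_card_neighborSet (hT : T.IsTree) (hinv : Function.Involutive σ)
    (hσ : ∀ v, T.Adj v (σ v)) {c : V} (hc : T.IsMatchingCenter σ c) :
    2 * Nat.card (T.neighborSet c) = Fintype.card V := by
  classical
  have hcompl : (T.neighborFinset c)ᶜ = (T.neighborFinset c).image σ := by
    ext x
    simp only [mem_compl, mem_neighborFinset, mem_image]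
    constructor
    · exact fun hx => ⟨σ x, (hc x).resolve_left hx, hinv x⟩
    · rintro ⟨y, hy, rfl⟩ hy'
      exact hT.dist_ne_of_adj c (hσ y)
        ((dist_eq_one_iff_adj.2 hy).trans (dist_eq_one_iff_adj.2 hy').symm)
  have h := card_add_card_compl (T.neighborFinset c)
  rw [hcompl, card_image_of_injective _ hinv.injective] at h
  rw [Nat.card_eq_fintype_card, card_neighborSet_eq_degree, ← card_neighborFinset_eq_degree]
  omega

theorem IsMatchingCenter.nonempty_iso_spur (hT : T.IsTree) (hinv : Function.Involutive σ)
    (hσ : ∀ v, T.Adj v (σ v)) {n : ℕ} (hcard : Fintype.card V = n) {c : V}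
    (hc : T.IsMatchingCenter σ c) : Nonempty (T ≃g spur n (n / 2)) := by
  classical
  have hk := hc.two_mul_card_neighborSet hT hinv hσ
  obtain ⟨e₀⟩ : Nonempty (Fin (n / 2) ≃ T.neighborSet c) :=
    ⟨(Finite.equivFinOfCardEq (by omega)).symm⟩
  let s : T.neighborSet c := ⟨σ c, hσ c⟩
  have hpos : 0 < n / 2 := (e₀.symm s).pos
  let l : Fin (n / 2) := ⟨n / 2 - 1, by omega⟩
  let e : Fin (n / 2) ≃ T.neighborSet c := e₀.trans (Equiv.swap (e₀ l) s)
  have hel : (e l : V) = σ c := by simp [e, s]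
  have hlegs : ∀ i, spurLegs n (n / 2) i = if i = l then 1 else 2 := by
    intro i
    have hi := i.2
    simp only [spurLegs, l, Fin.ext_iff]
    split_ifs <;> omega
  have hadj : ∀ i, T.Adj c (e i) := fun i => (e i).2
  have hd : ∀ i, T.dist c (e i) = 1 := fun i => dist_eq_one_iff_adj.2 (hadj i)
  have hinj : ∀ {i j}, (e i : V) = e j → i = j := fun h => e.injective (Subtype.ext h)
  have hd' : ∀ i, i ≠ l → T.dist c (σ (e i)) = 2 := by
    intro i hi
    have hne : c ≠ σ (e i) := fun h => hi (hinj (by rw [hel, ← hinv (e i), ← h]))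
    have := hT.dist_eq_add_one_of_dist_lt (x := c) (hadj i) (hσ (e i)).symm hne (by simp [hd])
    rw [this, hd]
  let f : Option (Σ i : Fin (n / 2), Fin (spurLegs n (n / 2) i)) → V := fun o =>
    match o with
    | none => c
    | some p => if (p.2 : ℕ) = 0 then e p.1 else σ (e p.1)
  have hj : ∀ i (j : Fin (spurLegs n (n / 2) i)), (j : ℕ) = 0 ∨ ((j : ℕ) = 1 ∧ i ≠ l) := by
    intro i j
    have h := j.2.trans_eq (hlegs i)
    split_ifs at h with hi
    · left; omega
    · have : (j : ℕ) = 0 ∨ (j : ℕ) = 1 := by omega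
      exact this.imp_right fun h => ⟨h, hi⟩
  have hf0 : ∀ i (j : Fin (spurLegs n (n / 2) i)), (j : ℕ) = 0 → f (some ⟨i, j⟩) = e i :=
    fun i j h => if_pos h
  have hf1 : ∀ i (j : Fin (spurLegs n (n / 2) i)), (j : ℕ) = 1 → f (some ⟨i, j⟩) = σ (e i) :=
    fun i j h => if_neg (by simp [h])
  have hsome : ∀ i i' (j : Fin (spurLegs n (n / 2) i)) (j' : Fin (spurLegs n (n / 2) i')),
      i = i' → (j : ℕ) = j' → some (⟨i, j⟩ : Σ i : Fin (n / 2), Fin (spurLegs n (n / 2) i)) =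
        some ⟨i', j'⟩ := by
    rintro i _ j j' rfl h
    rw [Fin.ext h]
  have finj : Function.Injective f := by
    have hn : f none = c := rfl
    rintro (_ | ⟨i, j⟩) (_ | ⟨i', j'⟩) h
    · rfl
    · have h := congrArg (T.dist c) h
      rcases hj i' j' with h' | ⟨h', hl'⟩
      · rw [hf0 _ _ h', hn, hd, dist_self] at h; omega
      · rw [hf1 _ _ h', hn, hd' _ hl', dist_self] at h; omega
    · have h := congrArg (T.dist c) h
      rcases hj i j with h' | ⟨h', hl'⟩
      · rw [hf0 _ _ h', hn, hd, dist_self] at h; omega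
      · rw [hf1 _ _ h', hn, hd' _ hl', dist_self] at h; omega
    · have hdist := congrArg (T.dist c) h
      rcases hj i j with h₁ | ⟨h₁, hl₁⟩ <;> rcases hj i' j' with h₂ | ⟨h₂, hl₂⟩
      · rw [hf0 _ _ h₁, hf0 _ _ h₂] at h
        exact hsome _ _ _ _ (hinj h) (by omega)
      · rw [hf0 _ _ h₁, hf1 _ _ h₂, hd, hd' _ hl₂] at hdist; omega
      · rw [hf1 _ _ h₁, hf0 _ _ h₂, hd, hd' _ hl₁] at hdist; omega
      · rw [hf1 _ _ h₁, hf1 _ _ h₂] at h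
        exact hsome _ _ _ _ (hinj (hinv.injective h)) (by omega)
  have fsurj : Function.Surjective f := by
    have hadj_surj : ∀ x, T.Adj c x → ∃ i, (e i : V) = x := fun x hx =>
      ⟨e.symm ⟨x, hx⟩, by simp⟩
    intro x
    rcases hc x with hx | hx
    · obtain ⟨i, rfl⟩ := hadj_surj x hx
      exact ⟨some ⟨i, ⟨0, by rw [hlegs]; split_ifs <;> omega⟩⟩, hf0 _ _ rfl⟩
    · obtain ⟨i, hi⟩ := hadj_surj _ hx
      by_cases hil : i = l
      · exact ⟨none, hinv.injective (by rw [← hi, hil, hel])⟩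
      · exact ⟨some ⟨i, ⟨1, by rw [hlegs, if_neg hil]; omega⟩⟩,
          (hf1 _ _ rfl).trans (by rw [hi, hinv])⟩
  have fadj : ∀ o o', T.Adj (f o) (f o') ↔ (spur n (n / 2)).Adj o o' := by
    have hfwd : ∀ o o', T.Adj (f o) (f o') → T.dist c (f o) < T.dist c (f o') →
        (spur n (n / 2)).Adj o o' := by
      intro o o' h hlt
      refine (fromRel_adj _ _ _).2 ⟨fun h' => h.ne (congrArg f h'), Or.inl ?_⟩
      have h₁ := hT.dist_eq_dist_add_one_of_adj c h
      rcases o' with _ | ⟨i', j'⟩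
      · exact absurd hlt (by simp [f])
      rcases o with _ | ⟨i, j⟩
      · left
        refine ⟨i', j', rfl, rfl, (hj i' j').resolve_right ?_⟩
        rintro ⟨h₂, hl₂⟩
        rw [hf1 _ _ h₂, hd' _ hl₂, show f none = c from rfl, dist_self] at h₁
        omega
      · right
        rcases hj i j with h₂ | ⟨h₂, hl₂⟩ <;> rcases hj i' j' with h₃ | ⟨h₃, hl₃⟩
        · rw [hf0 _ _ h₂, hf0 _ _ h₃, hd, hd] at hlt; omega
        · rw [hf0 _ _ h₂, hf1 _ _ h₃] at h
          have hii : i = i' := hinj (hT.eq_of_adj_of_dist_lt (x := c) h (hσ (e i'))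
            (by rw [hd, hd' _ hl₃]; omega) (by rw [hd, hd' _ hl₃]; omega))
          subst hii
          exact ⟨i, j, j', rfl, rfl, by omega⟩
        · rw [hf1 _ _ h₂, hf0 _ _ h₃, hd, hd' _ hl₂] at hlt; omega
        · rw [hf1 _ _ h₂, hf1 _ _ h₃, hd' _ hl₃, hd' _ hl₂] at hlt; omega
    have hbwd : ∀ o o', ((∃ (i : Fin (n / 2)) (j : Fin (spurLegs n (n / 2) i)),
          o = none ∧ o' = some ⟨i, j⟩ ∧ (j : ℕ) = 0) ∨
        (∃ (i : Fin (n / 2)) (j j' : Fin (spurLegs n (n / 2) i)),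
          o = some ⟨i, j⟩ ∧ o' = some ⟨i, j'⟩ ∧ (j' : ℕ) = (j : ℕ) + 1)) →
        T.Adj (f o) (f o') := by
      rintro o o' (⟨i, j, rfl, rfl, h⟩ | ⟨i, j, j', rfl, rfl, h⟩)
      · rw [hf0 _ _ h]
        exact hadj i
      · have h₁ := hj i j
        have h₂ := hj i j'
        rw [hf0 _ _ (by omega), hf1 _ _ (by omega)]
        exact hσ _
    intro o o'
    constructor
    · intro h
      rcases hT.dist_eq_dist_add_one_of_adj c h with h' | h'
      · exact (hfwd o' o h.symm (by omega)).symm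
      · exact hfwd o o' h (by omega)
    · intro h
      rcases ((fromRel_adj _ _ _).1 h).2 with h' | h'
      · exact hbwd o o' h'
      · exact (hbwd o' o h').symm
  exact ⟨(RelIso.mk (Equiv.ofBijective f ⟨finj, fsurj⟩) (fadj _ _) : spur n (n / 2) ≃g T).symm⟩

end Spur

section Harary

variable {V : Type*} {T : SimpleGraph V} {σ : V → V}

/-- Sum of `F` over the four pairs of ends of the matching edges at `u` and at `v`. -/
def blockSum (σ : V → V) (F : V → V → ℝ) (u v : V) : ℝ :=
  F u v + F u (σ v) + F (σ u) v + F (σ u) (σ v)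

theorem sum_blockSum [Fintype V] (hinv : Function.Involutive σ) (F : V → V → ℝ) :
    ∑ u, ∑ v, blockSum σ F u v = 4 * ∑ u, ∑ v, F u v := by
  have h : ∀ g : V → ℝ, ∑ v, g (σ v) = ∑ v, g v := fun g => Equiv.sum_comp hinv.toPerm g
  simp only [blockSum, sum_add_distrib, h (F _)]
  rw [h fun u => ∑ v, F u v]
  ring

theorem harary_eq_sum [Fintype V] (T : SimpleGraph V) :
    harary T = (∑ u, ∑ v, (1 : ℝ) / T.dist u v) / 2 := by
  unfold harary
  congr 1
  refine sum_congr rfl fun u _ => sum_congr rfl fun v _ => ?_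
  split_ifs with h
  · simp [h]
  · rfl

open Classical in
/-- The extremal value of the reciprocal-distance sum over the pairs of ends of two matching
edges: `17 / 12` for edges at distance at least `2`, `7 / 3` for adjacent ones, `2` for equal. -/
noncomputable def blockBound (T : SimpleGraph V) (σ : V → V) (u v : V) : ℝ :=
  17 / 12 + 11 / 12 * blockSum σ (fun a b => if T.Adj a b then 1 else 0) u v
    - 5 / 4 * (if u = v then 1 else 0) - 5 / 4 * (if σ u = v then 1 else 0)

open Classical in
theorem IsTree.sum_adj [Fintype V] (hT : T.IsTree) :
    ∑ u, ∑ v, (if T.Adj u v then (1 : ℝ) else 0) = 2 * (Fintype.card V - 1) := by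
  have h₁ := T.sum_degrees_eq_twice_card_edges
  have h₂ := hT.card_edgeFinset
  have h₃ : ∀ u, ∑ v, (if T.Adj u v then (1 : ℝ) else 0) = T.degree u := fun u => by
    rw [sum_boole, ← card_neighborFinset_eq_degree, neighborFinset_eq_filter]
  simp only [h₃]
  rw [← h₂]
  push_cast
  rw [add_sub_cancel_right]
  exact_mod_cast h₁

theorem IsTree.sum_blockBound [Fintype V] (hT : T.IsTree) (hinv : Function.Involutive σ) :
    ∑ u, ∑ v, blockBound T σ u v =
      8 * ((17 * (Fintype.card V : ℝ) ^ 2 + 58 * (Fintype.card V : ℝ) - 88) / 96) := by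
  classical
  simp only [blockBound, sum_sub_distrib, sum_add_distrib, ← mul_sum]
  rw [sum_blockSum hinv, hT.sum_adj]
  simp
  ring

theorem reciprocal_sum_le {t : ℕ} (ht : 2 ≤ t) :
    (1 : ℝ) / t + 2 * (1 / (t + 1 : ℕ)) + 1 / (t + 2 : ℕ) ≤ 17 / 12 ∧
    ((1 : ℝ) / t + 2 * (1 / (t + 1 : ℕ)) + 1 / (t + 2 : ℕ) = 17 / 12 ↔ t = 2) := by
  have key : 3 ≤ t → (1 : ℝ) / t + 2 * (1 / (t + 1 : ℕ)) + 1 / (t + 2 : ℕ) < 17 / 12 := by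
    intro h
    have h₁ : (1 : ℝ) / t ≤ 1 / (3 : ℕ) := one_div_le_one_div_of_le (by norm_num) (by exact_mod_cast h)
    have h₂ : (1 : ℝ) / (t + 1 : ℕ) ≤ 1 / (4 : ℕ) :=
      one_div_le_one_div_of_le (by norm_num) (by exact_mod_cast (by omega : 4 ≤ t + 1))
    have h₃ : (1 : ℝ) / (t + 2 : ℕ) ≤ 1 / (5 : ℕ) :=
      one_div_le_one_div_of_le (by norm_num) (by exact_mod_cast (by omega : 5 ≤ t + 2))
    norm_num at h₁ h₂ h₃ ⊢
    linarith
  rcases ht.eq_or_lt with rfl | h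
  · norm_num
  · have := key h
    exact ⟨this.le, fun h' => absurd h' this.ne, fun h' => by omega⟩

theorem IsTree.blockSum_le_blockBound (hT : T.IsTree) (hinv : Function.Involutive σ)
    (hσ : ∀ v, T.Adj v (σ v)) (u v : V) :
    blockSum σ (fun a b => (1 : ℝ) / T.dist a b) u v ≤ blockBound T σ u v ∧
    (blockSum σ (fun a b => (1 : ℝ) / T.dist a b) u v = blockBound T σ u v ↔
      (T.dist u v ≤ 2 ∨ T.dist u (σ v) ≤ 2 ∨ T.dist (σ u) v ≤ 2 ∨ T.dist (σ u) (σ v) ≤ 2)) := by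
  classical
  have hd : ∀ x, T.dist x (σ x) = 1 := fun x => dist_eq_one_iff_adj.2 (hσ x)
  have hd' : ∀ x, T.dist (σ x) x = 1 := fun x => dist_eq_one_iff_adj.2 (hσ x).symm
  by_cases huv : u = v
  · subst huv
    have h : σ u ≠ u := (hσ u).ne'
    simp [blockSum, blockBound, hd, hd', hσ, (hσ u).symm, h]
    norm_num
  by_cases hsuv : σ u = v
  · subst hsuv
    simp [blockSum, blockBound, hd, hd', hσ, (hσ u).symm, huv, hinv u]
    norm_num
  have h₂ : u ≠ σ v := fun h => hsuv (by rw [h, hinv])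
  have h₄ : σ u ≠ σ v := fun h => huv (hinv.injective h)
  obtain ⟨t, ht, h⟩ := hT.dist_disjoint_edges (hσ u) (hσ v) huv h₂ hsuv h₄
  have hsum : blockSum σ (fun a b => (1 : ℝ) / T.dist a b) u v =
      1 / t + 2 * (1 / (t + 1 : ℕ)) + 1 / (t + 2 : ℕ) := by
    simp only [blockSum]
    rcases h with ⟨a, b, c, d⟩ | ⟨a, b, c, d⟩ | ⟨a, b, c, d⟩ | ⟨a, b, c, d⟩ <;>
      rw [a, b, c, d] <;> ring
  have hbound : blockBound T σ u v = 17 / 12 + 11 / 12 * (if t = 1 then 1 else 0) := by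
    simp only [blockBound, blockSum, ← dist_eq_one_iff_adj, if_neg huv, if_neg hsuv]
    rcases h with ⟨a, b, c, d⟩ | ⟨a, b, c, d⟩ | ⟨a, b, c, d⟩ | ⟨a, b, c, d⟩ <;>
      · rw [a, b, c, d]
        simp [show t ≠ 0 by omega]
  have hmin : (T.dist u v ≤ 2 ∨ T.dist u (σ v) ≤ 2 ∨ T.dist (σ u) v ≤ 2 ∨
      T.dist (σ u) (σ v) ≤ 2) ↔ t ≤ 2 := by omega
  rw [hsum, hbound, hmin]
  rcases ht.eq_or_lt with rfl | ht
  · norm_num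
  · rw [if_neg (by omega), mul_zero, add_zero]
    obtain ⟨hle, heq⟩ := reciprocal_sum_le ht
    exact ⟨hle, heq.trans ⟨fun h => h.le, fun h => le_antisymm h ht⟩⟩

theorem IsTree.harary_le_iff_matchingClose [Fintype V] (hT : T.IsTree)
    (hinv : Function.Involutive σ) (hσ : ∀ v, T.Adj v (σ v)) :
    harary T ≤ (17 * (Fintype.card V : ℝ) ^ 2 + 58 * (Fintype.card V : ℝ) - 88) / 96 ∧
    (harary T = (17 * (Fintype.card V : ℝ) ^ 2 + 58 * (Fintype.card V : ℝ) - 88) / 96 ↔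
      T.MatchingClose σ) := by
  have hH : ∑ u, ∑ v, blockSum σ (fun a b => (1 : ℝ) / T.dist a b) u v = 8 * harary T := by
    rw [sum_blockSum hinv, harary_eq_sum]
    ring
  have hB := hT.sum_blockBound hinv
  have hle := fun u v => (hT.blockSum_le_blockBound hinv hσ u v).1
  have hrow : ∀ u ∈ univ, ∑ v, blockSum σ (fun a b => (1 : ℝ) / T.dist a b) u v ≤
      ∑ v, blockBound T σ u v := fun u _ => sum_le_sum fun v _ => hle u v
  have hsum := sum_le_sum hrow
  rw [hH, hB] at hsum
  refine ⟨by linarith, ?_⟩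
  have heq := sum_eq_sum_iff_of_le hrow
  rw [hH, hB, mul_right_inj' (by norm_num : (8 : ℝ) ≠ 0)] at heq
  rw [heq]
  simp only [sum_eq_sum_iff_of_le fun v _ => hle _ v, mem_univ, true_imp_iff,
    (hT.blockSum_le_blockBound hinv hσ _ _).2, MatchingClose]

end Harary

end SimpleGraph

theorem harary_perfect_matching_bound {V : Type*} [Fintype V] (T : SimpleGraph V)
    (hT : T.IsTree) (n : ℕ) (hn : Even n) (hcard : Fintype.card V = n)
    (hpm : ∃ M : T.Subgraph, M.IsPerfectMatching) :
    harary T ≤ (17 * (n : ℝ) ^ 2 + 58 * (n : ℝ) - 88) / 96 ∧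
    (harary T = (17 * (n : ℝ) ^ 2 + 58 * (n : ℝ) - 88) / 96 ↔
      Nonempty (T ≃g spur n (n / 2))) := by
  subst hcard
  obtain ⟨M, hM⟩ := hpm
  obtain ⟨σ, hinv, hσ⟩ := hM.exists_involutive
  obtain ⟨hle, heq⟩ := hT.harary_le_iff_matchingClose hinv hσ
  refine ⟨hle, heq.trans ⟨fun h => ?_, fun ⟨φ⟩ => ?_⟩⟩
  · obtain ⟨c, hc⟩ := h.exists_isMatchingCenter hT hinv hσ
    exact hc.nonempty_iso_spur hT hinv hσ rfl
  · exact (isMatchingCenter_of_iso_spur hσ φ).matchingClose hT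
end
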